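/- arXiv:1206.3176 — 3 statements merged into one kernel-verified Lean document; each statement's English description precedes it below -/
import Mathlib

section
/- Let Ω ⊆ ℝ^{n+1} be a nonempty proper open convex cone with open dual cone Ω*, let F_Ω be a canonical potential of Ω, and let F_{Ω*} be a canonical potential of Ω*. Then for every x ∈ Ω: (a) F_Ω(x) + F_{Ω*}(−∇F_Ω(x)) = 0 (equivalently e^{F_Ω(x)}·e^{F_{Ω*}(−∇F_Ω(x))} = 1); and (b) −∇F_{Ω*}(−∇F_Ω(x)) = x, i.e. the maps x ↦ −∇F_Ω(x) and y ↦ −∇F_{Ω*}(y) are mutually inverse bijections between Ω and Ω*. -/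
open scoped RealInnerProductSpace

noncomputable section

abbrev Euc (m : ℕ) : Type := EuclideanSpace ℝ (Fin m)

/-- The Hessian matrix of `F` at `x` in the standard coordinates. -/
def hessMatrix {m : ℕ} (F : Euc m → ℝ) (x : Euc m) : Matrix (Fin m) (Fin m) ℝ :=
  fun i j => iteratedFDeriv ℝ 2 F x ![EuclideanSpace.single i 1, EuclideanSpace.single j 1]

/-- A nonempty proper open convex cone in `ℝ^m`. -/
def IsOpenProperConvexCone {m : ℕ} (Ω : Set (Euc m)) : Prop :=
  Ω.Nonempty ∧ IsOpen Ω ∧ Convex ℝ Ω ∧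
    (∀ x ∈ Ω, ∀ t : ℝ, Real.exp t • x ∈ Ω) ∧
    ¬ ∃ p v : Euc m, v ≠ 0 ∧ ∀ t : ℝ, p + t • v ∈ closure Ω

/-- `F` tends to `+∞` along every sequence in `Ω` converging to a boundary point of `Ω`. -/
def BlowsUpOnBoundary {m : ℕ} (Ω : Set (Euc m)) (F : Euc m → ℝ) : Prop :=
  ∀ z ∈ frontier Ω, ∀ x : ℕ → Euc m, (∀ k, x k ∈ Ω) →
    Filter.Tendsto x Filter.atTop (nhds z) →
    Filter.Tendsto (fun k => F (x k)) Filter.atTop Filter.atTop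

/-- The canonical potential of a proper open convex cone `Ω ⊆ ℝ^{n+1}`. -/
def IsCanonicalPotential (n : ℕ) (Ω : Set (Euc (n+1))) (F : Euc (n+1) → ℝ) : Prop :=
  ContDiffOn ℝ (⊤ : ℕ∞) F Ω ∧
  (∀ x ∈ Ω, (hessMatrix F x).PosDef) ∧
  (∀ x ∈ Ω, (hessMatrix F x).det = Real.exp (2 * F x)) ∧
  (∀ x ∈ Ω, ∀ t : ℝ, F (Real.exp t • x) = F x - (n + 1) * t) ∧
  BlowsUpOnBoundary Ω F

/-- The open dual cone of `Ω`. -/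
def openDualCone {m : ℕ} (Ω : Set (Euc m)) : Set (Euc m) :=
  {y | ∀ x ∈ closure Ω, x ≠ 0 → 0 < ⟪x, y⟫}


section LinAlg

variable {E : Type*} [NormedAddCommGroup E] [InnerProductSpace ℝ E] [FiniteDimensional ℝ E]

lemma one_le_det_of_one_le (N : E →ₗ[ℝ] E) (hN : N.IsSymmetric)
    (h : ∀ v, ⟪v, v⟫ ≤ ⟪N v, v⟫) : 1 ≤ LinearMap.det N := by
  have hn : Module.finrank ℝ E = Module.finrank ℝ E := rfl
  rw [hN.det_eq_prod_eigenvalues hn]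
  have h1 : ∀ i, (1 : ℝ) ≤ hN.eigenvalues hn i := by
    intro i
    have h2 := h (hN.eigenvectorBasis hn i)
    rw [hN.apply_eigenvectorBasis hn i] at h2
    simp [inner_smul_left] at h2
    exact h2
  simpa using Finset.one_le_prod (s := Finset.univ) (fun i _ => h1 i)

lemma exists_normalizer (P : E →ₗ[ℝ] E) (hP : P.IsSymmetric)
    (hpos : ∀ v, v ≠ 0 → 0 < ⟪P v, v⟫) :
    ∃ B : E →ₗ[ℝ] E, ∀ v w, ⟪P (B v), B w⟫ = ⟪v, w⟫ := by
  have hn : Module.finrank ℝ E = Module.finrank ℝ E := rfl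
  set b := hP.eigenvectorBasis hn with hb
  set l := hP.eigenvalues hn with hl
  have hlpos : ∀ i, 0 < l i := by
    intro i
    have h2 := hpos (b i) (b.orthonormal.ne_zero i)
    rw [hP.apply_eigenvectorBasis hn i] at h2
    simpa [inner_smul_left, ← hb, ← hl] using h2
  refine ⟨b.toBasis.constr ℝ (fun i => (Real.sqrt (l i))⁻¹ • b i), ?_⟩
  set B := b.toBasis.constr ℝ (fun i => (Real.sqrt (l i))⁻¹ • b i) with hB
  have hBi : ∀ i, B (b i) = (Real.sqrt (l i))⁻¹ • b i := by
    intro i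
    have := b.toBasis.constr_basis ℝ (fun i => (Real.sqrt (l i))⁻¹ • b i) i
    simpa only [OrthonormalBasis.coe_toBasis] using this
  have key : ((LinearMap.compl₁₂ (innerₗ E) (P ∘ₗ B) B : E →ₗ[ℝ] E →ₗ[ℝ] ℝ)) = innerₗ E := by
    refine LinearMap.ext_basis b.toBasis b.toBasis ?_
    intro i j
    have hPi : P (b i) = l i • b i := hP.apply_eigenvectorBasis hn i
    simp only [LinearMap.compl₁₂_apply, LinearMap.comp_apply, OrthonormalBasis.coe_toBasis,
      innerₗ_apply_apply, hBi, map_smul, hPi]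
    simp only [LinearMap.smul_apply, innerₗ_apply_apply, smul_eq_mul]
    rw [orthonormal_iff_ite.mp b.orthonormal i j]
    by_cases hij : i = j
    · subst hij
      have := Real.mul_self_sqrt (hlpos i).le
      have h3 := Real.sqrt_pos.mpr (hlpos i)
      simp
      field_simp
      nlinarith
    · simp [hij]
  intro v w
  have := congrArg (fun f => f v w) key
  simpa using this

lemma det_mono_of_le (P Q : E →ₗ[ℝ] E) (hP : P.IsSymmetric) (hQ : Q.IsSymmetric)
    (hpos : ∀ v, v ≠ 0 → 0 < ⟪P v, v⟫) (hle : ∀ v, ⟪P v, v⟫ ≤ ⟪Q v, v⟫) :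
    LinearMap.det P ≤ LinearMap.det Q := by
  obtain ⟨B, hB⟩ := exists_normalizer P hP hpos
  have h1 : B.adjoint ∘ₗ P ∘ₗ B = LinearMap.id := by
    refine LinearMap.ext fun v => ?_
    refine ext_inner_right ℝ fun w => ?_
    simp [LinearMap.adjoint_inner_left, hB]
  have h2 : 1 ≤ LinearMap.det (B.adjoint ∘ₗ Q ∘ₗ B) := by
    apply one_le_det_of_one_le
    · intro v w
      simp [LinearMap.adjoint_inner_left, LinearMap.adjoint_inner_right]
      exact hQ _ _
    · intro v
      simp only [LinearMap.comp_apply, LinearMap.adjoint_inner_left]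
      rw [← hB]
      exact hle _
  have h3 := congrArg LinearMap.det h1
  rw [LinearMap.det_comp, LinearMap.det_comp, LinearMap.det_id] at h3
  rw [LinearMap.det_comp, LinearMap.det_comp] at h2
  have h4 : LinearMap.det B.adjoint = LinearMap.det B := by
    rw [← LinearMap.det_toMatrix (stdOrthonormalBasis ℝ E).toBasis B.adjoint,
      ← LinearMap.det_toMatrix (stdOrthonormalBasis ℝ E).toBasis B,
      LinearMap.toMatrix_adjoint, Matrix.det_conjTranspose]
    simp
  rw [h4] at h2 h3
  have h5 : 0 < LinearMap.det B * LinearMap.det B := by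
    have : LinearMap.det B ≠ 0 := by
      intro h; rw [h] at h3; simp at h3
    exact mul_self_pos.mpr this
  by_contra hcon
  push Not at hcon
  have := mul_lt_mul_of_pos_left hcon h5
  nlinarith

lemma det_rank_one (p l : E) (a : ℝ) :
    LinearMap.det ((LinearMap.id : E →ₗ[ℝ] E) + a • (innerₗ E l).smulRight p) = 1 + a * ⟪l, p⟫ := by
  have := LinearMap.transvection.det (a • innerₗ E l) p
  simp only [LinearMap.smul_apply, innerₗ_apply_apply, smul_eq_mul] at this
  rw [← this]
  congr 1
  ext x
  simp [LinearMap.transvection, mul_smul]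

end LinAlg

section Calc

/-- Necessary second order condition at a local minimum, in one variable. -/
lemma second_deriv_nonneg {k k' : ℝ → ℝ} {d : ℝ}
    (hk : ∀ᶠ s in nhds 0, HasDerivAt k (k' s) s) (hd : HasDerivAt k' d 0)
    (hmin : IsLocalMin k 0) : 0 ≤ d := by
  by_contra hneg
  push Not at hneg
  have he : deriv k =ᶠ[nhds 0] k' := hk.mono fun s hs => hs.deriv
  have h0 : deriv k 0 = 0 := hmin.deriv_eq_zero
  have h2 : deriv (deriv k) 0 = d := by rw [he.deriv_eq, hd.deriv]
  have hmax : IsLocalMax k 0 := isLocalMax_of_deriv_deriv_neg (by rw [h2]; exact hneg) h0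
    hk.self_of_nhds.continuousAt
  have hc : k =ᶠ[nhds 0] fun _ => k 0 := by
    filter_upwards [hmin, hmax] with s h1 h2 using le_antisymm h2 h1
  have h3 : deriv k =ᶠ[nhds 0] deriv fun _ => k 0 := hc.deriv
  have h4 : deriv (deriv k) 0 = 0 := by
    rw [h3.deriv_eq]; simp
  linarith

/-- Multivariate version. -/
lemma hess_nonneg {E : Type*} [NormedAddCommGroup E] [InnerProductSpace ℝ E]
    {k : E → ℝ} {g : E → E} {P : E →L[ℝ] E} {x : E}
    (hk : ∀ᶠ y in nhds x, HasFDerivAt k (innerSL ℝ (g y)) y) (hg : HasFDerivAt g P x)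
    (hmin : IsLocalMin k x) (v : E) : 0 ≤ ⟪P v, v⟫ := by
  have hline : ∀ s : ℝ, HasDerivAt (fun s : ℝ => x + s • v) v s := by
    intro s
    simpa using ((hasDerivAt_id s).smul_const v).const_add x
  have hcont : Filter.Tendsto (fun s : ℝ => x + s • v) (nhds 0) (nhds x) := by
    have := (hline 0).continuousAt.tendsto
    simpa using this
  refine second_deriv_nonneg (k := fun s => k (x + s • v)) (k' := fun s => ⟪g (x + s • v), v⟫)
    ?_ ?_ ?_
  · filter_upwards [hcont.eventually hk] with s hs
    exact hs.comp_hasDerivAt s (hline s)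
  · have h1 : HasDerivAt (fun s : ℝ => g (x + s • v)) (P v) 0 := by
      have hg' : HasFDerivAt g P (x + (0 : ℝ) • v) := by simpa using hg
      exact hg'.comp_hasDerivAt 0 (hline 0)
    simpa using h1.inner ℝ (hasDerivAt_const 0 v)
  · have := hcont.eventually hmin
    simpa [IsLocalMin, IsMinFilter] using this

lemma exists_min_of_blowup {E : Type*} [NormedAddCommGroup E] [NormedSpace ℝ E]
    [FiniteDimensional ℝ E] {S : Set E} (hS : Bornology.IsBounded S) (hne : S.Nonempty)
    {f : E → ℝ} (hf : ContinuousOn f S)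
    (hb : ∀ z, z ∉ S → ∀ x : ℕ → E, (∀ k, x k ∈ S) → Filter.Tendsto x Filter.atTop (nhds z) →
      Filter.Tendsto (fun k => f (x k)) Filter.atTop Filter.atTop) :
    ∃ x ∈ S, ∀ y ∈ S, f x ≤ f y := by
  obtain ⟨x1, hx1⟩ := hne
  have hK : IsCompact {x | x ∈ S ∧ f x ≤ f x1} := by
    rw [isCompact_iff_isSeqCompact]
    intro x hx
    have : ProperSpace E := FiniteDimensional.proper ℝ E
    obtain ⟨z, hz, φ, hφ, hlim⟩ := tendsto_subseq_of_bounded hS (fun k => (hx k).1)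
    have hzS : z ∈ S := by
      by_contra hzS
      have := hb z hzS (x ∘ φ) (fun k => (hx _).1) hlim
      obtain ⟨k, hk⟩ := (this.eventually_gt_atTop (f x1)).exists
      exact absurd (hx (φ k)).2 (not_le.mpr hk)
    refine ⟨z, ⟨hzS, ?_⟩, φ, hφ, hlim⟩
    have ht : Filter.Tendsto (fun k => f ((x ∘ φ) k)) Filter.atTop (nhds (f z)) :=
      (hf z hzS).tendsto.comp (tendsto_nhdsWithin_iff.mpr
        ⟨hlim, Filter.Eventually.of_forall fun k => (hx _).1⟩)
    exact le_of_tendsto ht (Filter.Eventually.of_forall fun k => (hx _).2)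
  obtain ⟨x, hx, hmin⟩ := hK.exists_isMinOn ⟨x1, hx1, le_rfl⟩
    (hf.mono fun x hx => hx.1)
  refine ⟨x, hx.1, fun y hy => ?_⟩
  by_cases h : f y ≤ f x1
  · exact hmin ⟨hy, h⟩
  · exact hx.2.trans (not_le.mp h).le

end Calc

section Cone

structure OCone {m : ℕ} (C : Set (Euc m)) : Prop where
  isOpen : IsOpen C
  convex : Convex ℝ C
  smul : ∀ x ∈ C, ∀ r : ℝ, 0 < r → r • x ∈ C

lemma OCone.add_mem {m : ℕ} {C : Set (Euc m)} (hC : OCone C) {x z : Euc m} (hx : x ∈ C)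
    (hz : z ∈ closure C) : x + z ∈ C := by
  have hx' : x ∈ interior C := by rwa [hC.isOpen.interior_eq]
  have h := hC.convex.combo_interior_closure_mem_interior hx' hz
    (a := 1/2) (b := 1/2) (by norm_num) (by norm_num) (by norm_num)
  rw [hC.isOpen.interior_eq] at h
  have h2 := hC.smul _ h 2 (by norm_num)
  rw [smul_add, smul_smul, smul_smul] at h2
  norm_num at h2
  exact h2

lemma OCone.smul_closure {m : ℕ} {C : Set (Euc m)} (hC : OCone C) {z : Euc m}
    (hz : z ∈ closure C) {r : ℝ} (hr : 0 ≤ r) : r • z ∈ closure C := by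
  rcases hr.eq_or_lt with h | h
  · subst h
    obtain ⟨x, hx⟩ := closure_nonempty_iff.mp ⟨z, hz⟩
    rw [zero_smul]
    have ht : Filter.Tendsto (fun s : ℝ => s • x) (nhdsWithin 0 (Set.Ioi 0)) (nhds 0) := by
      have : Filter.Tendsto (fun s : ℝ => s • x) (nhds 0) (nhds ((0 : ℝ) • x)) :=
        (continuous_id.smul continuous_const).tendsto 0
      rw [zero_smul] at this
      exact this.mono_left nhdsWithin_le_nhds
    refine mem_closure_of_tendsto ht ?_
    filter_upwards [self_mem_nhdsWithin] with s hs using hC.smul x hx s hs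
  · exact map_mem_closure (continuous_const_smul r) hz fun x hx => hC.smul x hx r h

structure Sol (n : ℕ) (C : Set (Euc (n+1))) (u : Euc (n+1) → ℝ)
    (g : Euc (n+1) → Euc (n+1)) (P : Euc (n+1) → Euc (n+1) →L[ℝ] Euc (n+1)) : Prop where
  cone : OCone C
  grad : ∀ x ∈ C, HasFDerivAt u (innerSL ℝ (g x)) x
  hess : ∀ x ∈ C, HasStrictFDerivAt g (P x) x
  symm : ∀ x ∈ C, ∀ v w, ⟪P x v, w⟫ = ⟪v, P x w⟫
  pos : ∀ x ∈ C, ∀ v, v ≠ 0 → 0 < ⟪P x v, v⟫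
  det : ∀ x ∈ C, LinearMap.det (P x : Euc (n+1) →ₗ[ℝ] Euc (n+1)) = Real.exp (2 * u x)
  hom : ∀ x ∈ C, ∀ r : ℝ, 0 < r → u (r • x) = u x - (n+1) * Real.log r

namespace Sol

variable {n : ℕ} {C : Set (Euc (n+1))} {u : Euc (n+1) → ℝ}
    {g : Euc (n+1) → Euc (n+1)} {P : Euc (n+1) → Euc (n+1) →L[ℝ] Euc (n+1)}

lemma zero_notMem (h : Sol n C u g P) : (0 : Euc (n+1)) ∉ C := by
  intro h0
  have h1 := h.hom 0 h0 (Real.exp 1) (Real.exp_pos _)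
  rw [smul_zero, Real.log_exp] at h1
  have : (0 : ℝ) < n + 1 := by positivity
  linarith

lemma ne_zero (h : Sol n C u g P) {x : Euc (n+1)} (hx : x ∈ C) : x ≠ 0 :=
  fun h0 => h.zero_notMem (h0 ▸ hx)

lemma continuousOn (h : Sol n C u g P) : ContinuousOn u C := fun x hx =>
  (h.grad x hx).continuousAt.continuousWithinAt

lemma grad_hom (h : Sol n C u g P) {x : Euc (n+1)} (hx : x ∈ C) {r : ℝ} (hr : 0 < r) :
    g (r • x) = r⁻¹ • g x := by
  have h1 : HasFDerivAt (fun y => u (r • y)) (r • innerSL ℝ (g (r • x))) x := by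
    have h2 := (h.grad _ (h.cone.smul x hx r hr)).comp x
      ((hasFDerivAt_id x).const_smul r)
    have he : (innerSL ℝ (g (r • x))) ∘SL (r • ContinuousLinearMap.id ℝ (Euc (n+1)))
        = r • innerSL ℝ (g (r • x)) := by
      ext v
      simp
    rw [he] at h2
    exact h2
  have h3 : HasFDerivAt (fun y => u (r • y)) (innerSL ℝ (g x)) x := by
    have h4 : HasFDerivAt (fun y => u y - (n+1) * Real.log r) (innerSL ℝ (g x)) x :=
      (h.grad x hx).sub_const _
    refine h4.congr_of_eventuallyEq ?_
    filter_upwards [h.cone.isOpen.mem_nhds hx] with y hy using h.hom y hy r hr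
  have h5 := h1.unique h3
  have h6 : r • g (r • x) = g x := by
    refine ext_inner_right ℝ fun w => ?_
    have := congrArg (fun f => f w) h5
    simpa [inner_smul_left] using this
  rw [← h6, smul_smul, inv_mul_cancel₀ hr.ne', one_smul]

lemma grad_self (h : Sol n C u g P) {x : Euc (n+1)} (hx : x ∈ C) : ⟪g x, x⟫ = -(n+1) := by
  have hl : HasDerivAt (fun s : ℝ => s • x) x 1 := by
    simpa using (hasDerivAt_id (1 : ℝ)).smul_const x
  have hx' : HasFDerivAt u (innerSL ℝ (g x)) ((1 : ℝ) • x) := by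
    rw [one_smul]; exact h.grad x hx
  have h1 : HasDerivAt (fun s : ℝ => u (s • x)) ⟪g x, x⟫ 1 := by
    have h0 := hx'.comp_hasDerivAt (1 : ℝ) hl
    exact h0
  have h2 : HasDerivAt (fun s : ℝ => u x - (n+1) * Real.log s) (-((n+1) * (1 : ℝ)⁻¹)) 1 :=
    ((Real.hasDerivAt_log one_ne_zero).const_mul _).const_sub _
  have h3 : HasDerivAt (fun s : ℝ => u (s • x)) (-((n+1) * (1 : ℝ)⁻¹)) 1 := by
    refine h2.congr_of_eventuallyEq ?_
    filter_upwards [lt_mem_nhds (zero_lt_one' ℝ)] with s hs using h.hom x hx s hs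
  rw [h1.unique h3]; simp

lemma segment_mem (h : Sol n C u g P) {x y : Euc (n+1)} (hx : x ∈ C) (hy : y ∈ C) {s : ℝ}
    (hs : s ∈ Set.Icc (0 : ℝ) 1) : x + s • (y - x) ∈ C :=
  h.cone.convex.add_smul_sub_mem hx hy hs

lemma line_deriv (x v : Euc (n+1)) (s : ℝ) :
    HasDerivAt (fun s : ℝ => x + s • v) v s := by
  simpa using ((hasDerivAt_id s).smul_const v).const_add x

lemma grad_strictMono (h : Sol n C u g P) {x y : Euc (n+1)} (hx : x ∈ C) (hy : y ∈ C)
    (hne : x ≠ y) : ⟪g x, y - x⟫ < ⟪g y, y - x⟫ := by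
  have hd : ∀ s ∈ Set.Icc (0 : ℝ) 1, HasDerivAt (fun s : ℝ => ⟪g (x + s • (y - x)), y - x⟫)
      ⟪P (x + s • (y - x)) (y - x), y - x⟫ s := by
    intro s hs
    have h1 : HasDerivAt (fun s : ℝ => g (x + s • (y - x))) (P (x + s • (y - x)) (y - x)) s :=
      (h.hess _ (h.segment_mem hx hy hs)).hasFDerivAt.comp_hasDerivAt s (line_deriv x (y - x) s)
    simpa using h1.inner ℝ (hasDerivAt_const s (y - x))
  have hm : StrictMonoOn (fun s : ℝ => ⟪g (x + s • (y - x)), y - x⟫) (Set.Icc (0 : ℝ) 1) := by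
    refine strictMonoOn_of_deriv_pos (convex_Icc 0 1)
      (fun s hs => (hd s hs).continuousAt.continuousWithinAt) ?_
    intro s hs
    rw [interior_Icc] at hs
    have hs' := Set.Ioo_subset_Icc_self hs
    rw [(hd s hs').deriv]
    exact h.pos _ (h.segment_mem hx hy hs') _ (sub_ne_zero.mpr hne.symm)
  have := hm (Set.left_mem_Icc.mpr zero_le_one) (Set.right_mem_Icc.mpr zero_le_one) zero_lt_one
  simpa using this

lemma grad_mono (h : Sol n C u g P) {x y : Euc (n+1)} (hx : x ∈ C) (hy : y ∈ C) :
    ⟪g x, y - x⟫ ≤ ⟪g y, y - x⟫ := by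
  by_cases hne : x = y
  · subst hne; exact le_rfl
  · exact (h.grad_strictMono hx hy hne).le

lemma grad_injOn (h : Sol n C u g P) {x y : Euc (n+1)} (hx : x ∈ C) (hy : y ∈ C)
    (he : g x = g y) : x = y := by
  by_contra hne
  have := h.grad_strictMono hx hy hne
  rw [he] at this
  exact lt_irrefl _ this

/-- The gradient inequality. -/
lemma grad_le (h : Sol n C u g P) {x y : Euc (n+1)} (hx : x ∈ C) (hy : y ∈ C) :
    u x + ⟪g x, y - x⟫ ≤ u y := by
  have hd : ∀ s ∈ Set.Icc (0 : ℝ) 1, HasDerivAt (fun s : ℝ => u (x + s • (y - x)))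
      ⟪g (x + s • (y - x)), y - x⟫ s := by
    intro s hs
    have h0 := (h.grad _ (h.segment_mem hx hy hs)).comp_hasDerivAt s (line_deriv x (y - x) s)
    exact h0
  obtain ⟨s, hs, hs2⟩ := exists_hasDerivAt_eq_slope (fun s : ℝ => u (x + s • (y - x))) _
    zero_lt_one (fun s hs => (hd s hs).continuousAt.continuousWithinAt)
    (fun s hs => hd s (Set.Ioo_subset_Icc_self hs))
  have hs' := Set.Ioo_subset_Icc_self hs
  have h1 := h.grad_mono hx (h.segment_mem hx hy hs')
  rw [add_sub_cancel_left, inner_smul_right, inner_smul_right] at h1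
  have h2 := le_of_mul_le_mul_left h1 hs.1
  rw [hs2] at h2
  simp at h2
  linarith

lemma grad_nonpos_mem (h : Sol n C u g P) {x z : Euc (n+1)} (hx : x ∈ C) (hz : z ∈ C) :
    ⟪g x, z⟫ ≤ 0 := by
  by_contra hpos
  push Not at hpos
  -- choose a large multiple of `z`
  have key : ∀ t : ℝ, 1 ≤ t → u x + t * ⟪g x, z⟫ + (n + 1) ≤ u z := by
    intro t ht
    have ht0 : 0 < t := by linarith
    have h1 := h.grad_le hx (h.cone.smul z hz t ht0)
    rw [h.hom z hz t ht0, inner_sub_right, inner_smul_right, h.grad_self hx] at h1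
    have h2 := Real.log_nonneg ht
    have h3 : (0 : ℝ) ≤ (n + 1) * Real.log t := by positivity
    linarith
  have h1 := key (max 1 ((u z - u x) / ⟪g x, z⟫)) (le_max_left _ _)
  have h2 : (u z - u x) / ⟪g x, z⟫ * ⟪g x, z⟫ = u z - u x := div_mul_cancel₀ _ hpos.ne'
  have h3 := mul_le_mul_of_nonneg_right (le_max_right 1 ((u z - u x) / ⟪g x, z⟫)) hpos.le
  have : (0 : ℝ) < n + 1 := by positivity
  linarith

lemma grad_nonpos (h : Sol n C u g P) {x z : Euc (n+1)} (hx : x ∈ C) (hz : z ∈ closure C) :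
    ⟪g x, z⟫ ≤ 0 := by
  have hcl : IsClosed {z | ⟪g x, z⟫ ≤ 0} :=
    isClosed_le (continuous_const.inner continuous_id) continuous_const
  exact closure_minimal (fun z hz => h.grad_nonpos_mem hx hz) hcl hz

lemma grad_neg (h : Sol n C u g P) {x z : Euc (n+1)} (hx : x ∈ C) (hz : z ∈ closure C)
    (hz0 : z ≠ 0) : ⟪g x, z⟫ < 0 := by
  have hy := h.cone.add_mem hx hz
  have h1 := h.grad_strictMono hx hy (by simpa using hz0)
  rw [add_sub_cancel_left] at h1
  exact h1.trans_le (h.grad_nonpos hy hz)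

lemma neg_grad_mem (h : Sol n C u g P) {x : Euc (n+1)} (hx : x ∈ C) :
    -g x ∈ openDualCone C := by
  intro z hz hz0
  have := h.grad_neg hx hz hz0
  rw [inner_neg_right, real_inner_comm]
  linarith

lemma anti (h : Sol n C u g P) {x z : Euc (n+1)} (hx : x ∈ C) (hz : z ∈ closure C) :
    u (x + z) ≤ u x := by
  have hy := h.cone.add_mem hx hz
  have h1 := h.grad_le hy hx
  have h2 := h.grad_nonpos hy hz
  rw [sub_add_cancel_left, inner_neg_right] at h1
  linarith

end Sol

end Cone

section Compare

lemma det_clm_adjoint {E : Type*} [NormedAddCommGroup E] [InnerProductSpace ℝ E]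
    [FiniteDimensional ℝ E] [CompleteSpace E] (A : E →L[ℝ] E) :
    LinearMap.det ((ContinuousLinearMap.adjoint A : E →L[ℝ] E) : E →ₗ[ℝ] E)
      = LinearMap.det (A : E →ₗ[ℝ] E) := by
  have h : ((ContinuousLinearMap.adjoint A : E →L[ℝ] E) : E →ₗ[ℝ] E)
      = LinearMap.adjoint (A : E →ₗ[ℝ] E) := by
    refine LinearMap.ext fun v => ?_
    refine ext_inner_right ℝ fun w => ?_
    rw [LinearMap.adjoint_inner_left]
    exact ContinuousLinearMap.adjoint_inner_left A w v
  rw [h, ← LinearMap.det_toMatrix (stdOrthonormalBasis ℝ E).toBasis (LinearMap.adjoint _),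
      ← LinearMap.det_toMatrix (stdOrthonormalBasis ℝ E).toBasis (A : E →ₗ[ℝ] E),
      LinearMap.toMatrix_adjoint, Matrix.det_conjTranspose]
  simp

namespace Sol

variable {n : ℕ} {C : Set (Euc (n+1))} {u : Euc (n+1) → ℝ}
    {g : Euc (n+1) → Euc (n+1)} {P : Euc (n+1) → Euc (n+1) →L[ℝ] Euc (n+1)}

/-- A degree-zero homogeneous continuous function which blows up at nonzero boundary points
attains its minimum on the cone. -/
lemma exists_min (hu : Sol n C u g P) (hne : C.Nonempty) {k : Euc (n+1) → ℝ}
    (hk : ContinuousOn k C) (hhom : ∀ x ∈ C, ∀ r : ℝ, 0 < r → k (r • x) = k x)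
    (hb : ∀ z ∈ frontier C, z ≠ 0 → ∀ x : ℕ → Euc (n+1), (∀ i, x i ∈ C) →
      Filter.Tendsto x Filter.atTop (nhds z) →
      Filter.Tendsto (fun i => k (x i)) Filter.atTop Filter.atTop) :
    ∃ x ∈ C, ∀ y ∈ C, k x ≤ k y := by
  have hnorm : ∀ x ∈ C, ‖x‖⁻¹ • x ∈ C ∩ Metric.sphere 0 1 := by
    intro x hx
    have h0 : 0 < ‖x‖ := norm_pos_iff.mpr (hu.ne_zero hx)
    refine ⟨hu.cone.smul x hx _ (inv_pos.mpr h0), ?_⟩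
    simp [norm_smul, h0.ne']
  obtain ⟨x0, hx0⟩ := hne
  obtain ⟨x, hx, hmin⟩ := exists_min_of_blowup (S := C ∩ Metric.sphere 0 1)
    (Metric.isBounded_sphere.subset Set.inter_subset_right) ⟨_, hnorm x0 hx0⟩
    (hk.mono Set.inter_subset_left) (by
      intro z hz x hx hlim
      have hzs : z ∈ Metric.sphere (0 : Euc (n+1)) 1 :=
        Metric.isClosed_sphere.mem_of_tendsto hlim (Filter.Eventually.of_forall fun i => (hx i).2)
      have hzc : z ∈ closure C :=
        mem_closure_of_tendsto hlim (Filter.Eventually.of_forall fun i => (hx i).1)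
      have hzC : z ∉ C := fun h => hz ⟨h, hzs⟩
      refine hb z ⟨hzc, ?_⟩ ?_ x (fun i => (hx i).1) hlim
      · rwa [hu.cone.isOpen.interior_eq]
      · rintro rfl
        simp at hzs)
  refine ⟨x, hx.1, fun y hy => ?_⟩
  have h1 := hmin _ (hnorm y hy)
  rwa [hhom y hy _ (inv_pos.mpr (norm_pos_iff.mpr (hu.ne_zero hy)))] at h1

lemma compare_aux (hu : Sol n C u g P) {v : Euc (n+1) → ℝ}
    {g' : Euc (n+1) → Euc (n+1)} {P' : Euc (n+1) → Euc (n+1) →L[ℝ] Euc (n+1)}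
    (hv : Sol n C v g' P') (hb : BlowsUpOnBoundary C u) {p l : Euc (n+1)} (hp : p ∈ C)
    (hl : ∀ z ∈ closure C, z ≠ 0 → 0 < ⟪l, z⟫) {ε : ℝ} (hε : 0 < ε) :
    ∀ x ∈ C, v (x + (ε * ⟪l, x⟫) • p) ≤ u x := by
  set A : Euc (n+1) →L[ℝ] Euc (n+1) :=
    ContinuousLinearMap.id ℝ _ + ε • (innerSL ℝ l).smulRight p with hA
  have hAx : ∀ x, A x = x + (ε * ⟪l, x⟫) • p := by
    intro x
    simp [hA, mul_smul]
  have hlp : 0 < ⟪l, p⟫ := hl p (subset_closure hp) (hu.ne_zero hp)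
  have hAC : ∀ z ∈ closure C, z ≠ 0 → A z ∈ C := by
    intro z hz hz0
    rw [hAx, add_comm z]
    exact hu.cone.add_mem (hu.cone.smul p hp _ (mul_pos hε (hl z hz hz0))) hz
  have hAC' : ∀ z ∈ C, A z ∈ C := fun z hz => hAC z (subset_closure hz) (hu.ne_zero hz)
  have hdet : LinearMap.det (A : Euc (n+1) →ₗ[ℝ] Euc (n+1)) = 1 + ε * ⟪l, p⟫ := by
    rw [← det_rank_one p l ε]
    congr 1
  have hinj : ∀ w, w ≠ 0 → A w ≠ 0 := by
    intro w hw h0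
    rw [hAx] at h0
    have h1 : ⟪l, w⟫ * (1 + ε * ⟪l, p⟫) = 0 := by
      have := congrArg (fun y => ⟪l, y⟫) h0
      simp only [inner_add_right, inner_smul_right, inner_zero_right] at this
      linarith
    have h2 : 1 + ε * ⟪l, p⟫ ≠ 0 := by positivity
    have h3 : ⟪l, w⟫ = 0 := by
      rcases mul_eq_zero.mp h1 with h | h
      · exact h
      · exact absurd h h2
    rw [h3] at h0
    simp at h0
    exact hw h0
  have hvA : ∀ z ∈ closure C, z ≠ 0 → ContinuousAt (fun x => v (A x)) z := fun z hz hz0 =>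
    ContinuousAt.comp (g := v) (hv.grad _ (hAC z hz hz0)).continuousAt A.continuous.continuousAt
  obtain ⟨x0, hx0, hmin⟩ := hu.exists_min ⟨p, hp⟩ (k := fun x => u x - v (A x))
    (fun x hx => ((hu.grad x hx).continuousAt.sub
      (hvA x (subset_closure hx) (hu.ne_zero hx))).continuousWithinAt)
    (by
      intro x hx r hr
      simp only [map_smul]
      rw [hu.hom x hx r hr, hv.hom _ (hAC' x hx) r hr]
      ring)
    (by
      intro z hz hz0 x hx hlim
      have h1 := hb z hz x hx hlim
      have h2 : Filter.Tendsto (fun i => -v (A (x i))) Filter.atTop (nhds (-v (A z))) :=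
        ((hvA z hz.1 hz0).tendsto.comp hlim).neg
      simpa [sub_eq_add_neg] using h1.atTop_add h2)
  have hess := fun w => hess_nonneg (k := fun x => u x - v (A x))
    (g := fun y => g y - ContinuousLinearMap.adjoint A (g' (A y)))
    (P := P x0 - (ContinuousLinearMap.adjoint A) ∘L (P' (A x0)) ∘L A) (x := x0)
    (by
      filter_upwards [hu.cone.isOpen.mem_nhds hx0] with y hy
      have h1 := (hu.grad y hy).sub ((hv.grad _ (hAC' y hy)).comp y A.hasFDerivAt)
      have he : innerSL ℝ (g y) - (innerSL ℝ (g' (A y))) ∘SL A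
          = innerSL ℝ (g y - ContinuousLinearMap.adjoint A (g' (A y))) := by
        ext w
        simp [ContinuousLinearMap.adjoint_inner_left]
      rw [he] at h1
      exact h1)
    ((hu.hess x0 hx0).hasFDerivAt.sub ((ContinuousLinearMap.adjoint A).hasFDerivAt.comp x0
      ((hv.hess _ (hAC' x0 hx0)).hasFDerivAt.comp x0 A.hasFDerivAt)))
    (by
      filter_upwards [hu.cone.isOpen.mem_nhds hx0] with y hy using hmin y hy) w
  have hdetle := det_mono_of_le
    (((ContinuousLinearMap.adjoint A) ∘L (P' (A x0)) ∘L A : Euc (n+1) →L[ℝ] Euc (n+1)) :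
      Euc (n+1) →ₗ[ℝ] Euc (n+1)) (P x0 : Euc (n+1) →ₗ[ℝ] Euc (n+1))
    (by
      intro a b
      simp only [ContinuousLinearMap.coe_coe, ContinuousLinearMap.comp_apply,
        ContinuousLinearMap.adjoint_inner_left, ContinuousLinearMap.adjoint_inner_right]
      exact hv.symm _ (hAC' x0 hx0) _ _)
    (fun a b => hu.symm x0 hx0 a b)
    (by
      intro w hw
      simp only [ContinuousLinearMap.coe_coe, ContinuousLinearMap.comp_apply,
        ContinuousLinearMap.adjoint_inner_left]
      exact hv.pos _ (hAC' x0 hx0) _ (hinj w hw))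
    (by
      intro w
      have := hess w
      rw [sub_apply, inner_sub_left] at this
      simpa using this)
  rw [ContinuousLinearMap.toLinearMap_comp, ContinuousLinearMap.toLinearMap_comp, LinearMap.det_comp,
    LinearMap.det_comp, det_clm_adjoint, hv.det _ (hAC' x0 hx0), hu.det _ hx0, hdet] at hdetle
  have h0 : v (A x0) ≤ u x0 := by
    have h1 : Real.exp (2 * v (A x0)) ≤ Real.exp (2 * u x0) := by
      refine le_trans ?_ hdetle
      have h2 := Real.exp_pos (2 * v (A x0))
      have h3 : 0 < ε * ⟪l, p⟫ := mul_pos hε hlp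
      nlinarith [mul_pos h3 h2, mul_pos h3 (mul_pos h3 h2)]
    have := Real.exp_le_exp.mp h1
    linarith
  intro x hx
  have := hmin x hx
  rw [← hAx]
  linarith

lemma compare (hu : Sol n C u g P) {v : Euc (n+1) → ℝ}
    {g' : Euc (n+1) → Euc (n+1)} {P' : Euc (n+1) → Euc (n+1) →L[ℝ] Euc (n+1)}
    (hv : Sol n C v g' P') (hb : BlowsUpOnBoundary C u) {p l : Euc (n+1)} (hp : p ∈ C)
    (hl : ∀ z ∈ closure C, z ≠ 0 → 0 < ⟪l, z⟫) :
    ∀ x ∈ C, v x ≤ u x := by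
  intro x hx
  have hc : Filter.Tendsto (fun ε : ℝ => x + (ε * ⟪l, x⟫) • p) (nhdsWithin 0 (Set.Ioi 0))
      (nhds x) := by
    have h1 : Continuous (fun ε : ℝ => x + (ε * ⟪l, x⟫) • p) := by fun_prop
    have h2 := h1.tendsto 0
    simp only [zero_mul, zero_smul, add_zero] at h2
    exact h2.mono_left nhdsWithin_le_nhds
  have ht := (hv.grad x hx).continuousAt.tendsto.comp hc
  refine le_of_tendsto ht ?_
  filter_upwards [self_mem_nhdsWithin] with ε hε
  exact compare_aux hu hv hb hp hl hε x hx

/-- `-g` is onto the dual cone. -/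
lemma surj (hu : Sol n C u g P) (hne : C.Nonempty) (hb : BlowsUpOnBoundary C u)
    {y : Euc (n+1)} (hy : y ∈ openDualCone C) : ∃ x ∈ C, -g x = y := by
  have hn : (0 : ℝ) < n + 1 := by positivity
  have hyC : ∀ x ∈ C, 0 < ⟪x, y⟫ := fun x hx => hy x (subset_closure hx) (hu.ne_zero hx)
  have hcl : ∀ z ∈ closure C, z ≠ 0 →
      ContinuousAt (fun x : Euc (n+1) => (n + 1 : ℝ) * Real.log ⟪x, y⟫) z := by
    intro z hz hz0
    refine continuousAt_const.mul (ContinuousAt.log ?_ (hy z hz hz0).ne')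
    exact (continuous_id.inner continuous_const).continuousAt
  obtain ⟨x0, hx0, hmin⟩ := hu.exists_min hne (k := fun x => u x + (n + 1 : ℝ) * Real.log ⟪x, y⟫)
    (fun x hx => ((hu.grad x hx).continuousAt.add
      (hcl x (subset_closure hx) (hu.ne_zero hx))).continuousWithinAt)
    (by
      intro x hx r hr
      rw [hu.hom x hx r hr, inner_smul_left]
      simp only [conj_trivial]
      rw [Real.log_mul hr.ne' (hyC x hx).ne']
      ring)
    (by
      intro z hz hz0 x hx hlim
      exact (hb z hz x hx hlim).atTop_add ((hcl z hz.1 hz0).tendsto.comp hlim))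
  have hloc : IsLocalMin (fun x => u x + (n + 1 : ℝ) * Real.log ⟪x, y⟫) x0 := by
    filter_upwards [hu.cone.isOpen.mem_nhds hx0] with z hz using hmin z hz
  have h1 : HasFDerivAt (fun x : Euc (n+1) => ⟪x, y⟫) (innerSL ℝ y) x0 := by
    have h2 := (innerSL ℝ y).hasFDerivAt (x := x0)
    refine h2.congr_of_eventuallyEq (Filter.Eventually.of_forall fun x => ?_)
    simp [real_inner_comm]
  have h2 := (h1.log (hyC x0 hx0).ne').const_mul (n + 1 : ℝ)
  have h3 := hloc.hasFDerivAt_eq_zero ((hu.grad x0 hx0).add h2)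
  set c : ℝ := (n + 1) * ⟪x0, y⟫⁻¹ with hc
  have hcpos : 0 < c := mul_pos hn (inv_pos.mpr (hyC x0 hx0))
  have h4 : g x0 = -(c • y) := by
    refine ext_inner_right ℝ fun w => ?_
    have h5 := congrArg (fun f => f w) h3
    simp at h5
    rw [inner_neg_left, inner_smul_left]
    simp only [conj_trivial, hc]
    linarith
  refine ⟨c • x0, hu.cone.smul x0 hx0 c hcpos, ?_⟩
  rw [hu.grad_hom hx0 hcpos, h4, smul_neg, neg_neg, smul_smul, inv_mul_cancel₀ hcpos.ne', one_smul]

end Sol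

end Compare

section Barrier

namespace Sol

variable {n : ℕ} {C : Set (Euc (n+1))} {u : Euc (n+1) → ℝ}
    {g : Euc (n+1) → Euc (n+1)} {P : Euc (n+1) → Euc (n+1) →L[ℝ] Euc (n+1)}

/-- Along rays parallel to directions in the closed cone, a solution is unbounded below. -/
lemma barrier_aux (hu : Sol n C u g P) {p z : Euc (n+1)} (hp : p ∈ C) (hz : z ∈ closure C)
    (hz1 : ‖z‖ = 1) (c0 : ℝ) (hc0 : ∀ t : ℝ, 0 ≤ t → c0 ≤ u (p + t • z)) : False := by
  obtain ⟨r, hr, hball⟩ := Metric.nhds_basis_closedBall.mem_iff.mp (hu.cone.isOpen.mem_nhds hp)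
  obtain ⟨M1, hM1⟩ := ((isCompact_closedBall p r).image_of_continuousOn
    (hu.continuousOn.mono hball)).bddAbove
  have hM1' : ∀ w : Euc (n+1), ‖w‖ ≤ r → u (p + w) ≤ M1 := by
    intro w hw
    exact hM1 ⟨p + w, by simpa using hw, rfl⟩
  have hballC : ∀ w : Euc (n+1), ‖w‖ ≤ r → p + w ∈ C := fun w hw => hball (by simpa using hw)
  have htz : ∀ t : ℝ, 0 ≤ t → t • z ∈ closure C := fun t ht => hu.cone.smul_closure hz ht
  have hmem : ∀ w : Euc (n+1), ‖w‖ ≤ r → ∀ t : ℝ, 0 ≤ t → p + w + t • z ∈ C := fun w hw t ht =>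
    hu.cone.add_mem (hballC w hw) (htz t ht)
  have hup : ∀ w : Euc (n+1), ‖w‖ ≤ r → ∀ t : ℝ, 0 ≤ t → u (p + w + t • z) ≤ M1 :=
    fun w hw t ht => (hu.anti (hballC w hw) (htz t ht)).trans (hM1' w hw)
  set D : ℝ := M1 - c0 with hD
  have hD0 : 0 ≤ D := by
    have h1 := hc0 0 le_rfl
    have h2 := hM1' 0 (by simpa using hr.le)
    rw [zero_smul] at h1
    linarith
  set c1 : ℝ := c0 - 2 * D with hc1
  set a : ℝ := (3 * D + 1) / r ^ 2 with ha
  have ha0 : 0 < a := by positivity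
  have har : a * r ^ 2 = 3 * D + 1 := by
    rw [ha]; field_simp
  set b : ℝ := a * (Real.exp (2 * c1) / (2 * (2 * a) ^ (n + 1))) with hb
  have hb0 : 0 < b := by positivity
  set R : ℝ := (3 * D + 1) / b + 1 with hR
  have hR1 : 1 ≤ R := by
    have : 0 ≤ (3 * D + 1) / b := by positivity
    linarith
  have hR0 : 0 < R := by linarith
  have hbR : 3 * D < b * R ^ 2 := by
    have h1 : b * R = 3 * D + 1 + b := by rw [hR]; field_simp
    nlinarith [mul_pos hb0 hR0]
  -- the quadratic form
  set T : Euc (n+1) →L[ℝ] Euc (n+1) :=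
    (2 * a) • (ContinuousLinearMap.id ℝ _ + ((b - a) / a) • (innerSL ℝ z).smulRight z) with hT
  have hTx : ∀ h, T h = (2 * a) • h + (2 * (b - a) * ⟪z, h⟫) • z := by
    intro h
    simp only [hT, ContinuousLinearMap.smul_apply, ContinuousLinearMap.add_apply,
      ContinuousLinearMap.id_apply, ContinuousLinearMap.smulRight_apply, innerSL_apply_apply,
      smul_add, smul_smul]
    congr 2
    field_simp
  have hTdet : LinearMap.det (T : Euc (n+1) →ₗ[ℝ] Euc (n+1)) = Real.exp (2 * c1) / 2 := by
    have h1 : (T : Euc (n+1) →ₗ[ℝ] Euc (n+1)) = (2 * a) •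
      ((LinearMap.id : Euc (n+1) →ₗ[ℝ] Euc (n+1)) +
        ((b - a) / a) • (innerₗ (Euc (n+1)) z).smulRight z) := rfl
    rw [h1, LinearMap.det_smul, det_rank_one, real_inner_self_eq_norm_sq, hz1]
    simp only [finrank_euclideanSpace, Fintype.card_fin]
    rw [hb]
    field_simp
    ring
  have hTsymm : ∀ v w, ⟪T v, w⟫ = ⟪v, T w⟫ := by
    intro v w
    rw [hTx, hTx]
    simp only [inner_add_left, inner_add_right, inner_smul_left, inner_smul_right, conj_trivial]
    rw [real_inner_comm z v]
    ring
  have hTq : ∀ h, ⟪T h, h⟫ = 2 * (a * ‖h - ⟪z, h⟫ • z‖ ^ 2 + b * ⟪z, h⟫ ^ 2) := by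
    intro h
    rw [hTx, ← real_inner_self_eq_norm_sq]
    simp only [inner_add_left, inner_sub_left, inner_sub_right, inner_smul_left, inner_smul_right,
      conj_trivial]
    rw [real_inner_comm z h, real_inner_self_eq_norm_sq z, hz1]
    ring
  set xc : Euc (n+1) := p + R • z with hxc
  have hxcC : xc ∈ C := hu.cone.add_mem hp (htz R hR0.le)
  have hγ : ⟪g xc, z⟫ ≤ 0 := hu.grad_nonpos hxcC hz
  have hγR : -(R * ⟪g xc, z⟫) ≤ D := by
    have h1 := hu.grad_le hxcC hp
    have h2 := hc0 R hR0.le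
    have h3 := hM1' 0 (by simpa using hr.le)
    rw [add_zero] at h3
    have h4 : p - xc = -(R • z) := by rw [hxc]; abel
    rw [h4, inner_neg_right, inner_smul_right] at h1
    linarith
  have hw1 : ∀ w : Euc (n+1), ‖w‖ ≤ r → ⟪g xc, w⟫ ≤ D := by
    intro w hw
    have h1 := hu.grad_le hxcC (hmem w hw R hR0.le)
    have h2 := hc0 R hR0.le
    have h3 := hup w hw R hR0.le
    have h4 : p + w + R • z - xc = w := by rw [hxc]; abel
    rw [h4] at h1
    linarith
  have hw2 : ∀ w : Euc (n+1), ‖w‖ ≤ r → -D ≤ ⟪g xc, w⟫ := by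
    intro w hw
    have := hw1 (-w) (by simpa using hw)
    rw [inner_neg_right] at this
    linarith
  set K : Set (Euc (n+1)) :=
    {x | ‖(x - xc) - ⟪z, x - xc⟫ • z‖ ≤ r ∧ |⟪z, x - xc⟫| ≤ R} with hK
  have hdec : ∀ x, x = p + ((x - xc) - ⟪z, x - xc⟫ • z) + (R + ⟪z, x - xc⟫) • z := by
    intro x
    rw [add_smul, hxc]
    abel
  have hKC : ∀ x ∈ K, x ∈ C := by
    intro x hx
    rw [hdec x]
    exact hmem _ hx.1 _ (by have := (abs_le.mp hx.2).1; linarith)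
  have hin : ∀ x, ⟪g xc, x - xc⟫ = ⟪g xc, (x - xc) - ⟪z, x - xc⟫ • z⟫ + ⟪z, x - xc⟫ * ⟪g xc, z⟫ := by
    intro x
    rw [inner_sub_right (g xc) (x - xc), inner_smul_right]
    ring
  have hlow : ∀ x ∈ K, -(2 * D) ≤ ⟪g xc, x - xc⟫ := by
    intro x hx
    have h1 := hw2 _ hx.1
    have h2 := abs_le.mp hx.2
    rw [hin x]
    nlinarith
  have hWle : ∀ x ∈ K, u x - u xc - ⟪g xc, x - xc⟫ ≤ 3 * D := by
    intro x hx
    have h1 : u x ≤ M1 := by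
      rw [hdec x]
      exact hup _ hx.1 _ (by have := (abs_le.mp hx.2).1; linarith)
    have h2 := hc0 R hR0.le
    have h3 := hlow x hx
    linarith
  have hul : ∀ x ∈ K, c1 ≤ u x := by
    intro x hx
    have h1 := hu.grad_le hxcC (hKC x hx)
    have h2 := hc0 R hR0.le
    have h3 := hlow x hx
    linarith
  have hcn1 : Continuous fun x : Euc (n+1) => ‖(x - xc) - ⟪z, x - xc⟫ • z‖ := by fun_prop
  have hcn2 : Continuous fun x : Euc (n+1) => |⟪z, x - xc⟫| := by fun_prop
  have hKcl : IsClosed K :=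
    (isClosed_le hcn1 continuous_const).inter (isClosed_le hcn2 continuous_const)
  have hKb : Bornology.IsBounded K := by
    refine (Metric.isBounded_closedBall (x := p) (r := r + 2 * R)).subset ?_
    intro x hx
    rw [mem_closedBall_iff_norm]
    have h1 : x - p = ((x - xc) - ⟪z, x - xc⟫ • z) + (R + ⟪z, x - xc⟫) • z := by
      conv_lhs => rw [hdec x]
      abel
    rw [h1]
    refine (norm_add_le _ _).trans ?_
    rw [norm_smul, hz1, mul_one, Real.norm_eq_abs]
    have h2 := abs_le.mp hx.2
    have h3 : |R + ⟪z, x - xc⟫| ≤ 2 * R := abs_le.mpr ⟨by linarith, by linarith⟩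
    have h4 := hx.1
    linarith
  have hKcomp : IsCompact K := Metric.isCompact_of_isClosed_isBounded hKcl hKb
  have hxcK : xc ∈ K := by
    simp [hK, hr.le, hR0.le]
  have hqd : ∀ x, HasFDerivAt (fun x => (1 / 2 : ℝ) * ⟪T (x - xc), x - xc⟫)
      (innerSL ℝ (T (x - xc))) x := by
    intro x
    have h1 : HasFDerivAt (fun x => T (x - xc)) T x :=
      T.hasFDerivAt.comp x ((hasFDerivAt_id x).sub_const xc)
    have h2 : HasFDerivAt (fun x : Euc (n+1) => x - xc) (ContinuousLinearMap.id ℝ _) x :=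
      (hasFDerivAt_id x).sub_const xc
    have h3 := (h1.inner ℝ h2).const_mul (1 / 2 : ℝ)
    refine h3.congr_fderiv ?_
    ext w
    have h4 := hTsymm w (x - xc)
    have h5 := real_inner_comm (T (x - xc)) w
    change (1 / 2 : ℝ) * (⟪T (x - xc), w⟫ + ⟪T w, x - xc⟫) = ⟪T (x - xc), w⟫
    rw [h4]
    linarith
  set k : Euc (n+1) → ℝ := fun x => (1 / 2 : ℝ) * ⟪T (x - xc), x - xc⟫ - u x + ⟪g xc, x⟫ with hk
  have hkd : ∀ x ∈ C, HasFDerivAt k (innerSL ℝ (T (x - xc) - g x + g xc)) x := by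
    intro x hx
    have h1 := ((hqd x).sub (hu.grad x hx)).add ((innerSL ℝ (g xc)).hasFDerivAt (x := x))
    rw [← map_sub, ← map_add] at h1
    exact h1
  obtain ⟨x0, hx0, hmin⟩ := hKcomp.exists_isMinOn ⟨xc, hxcK⟩
    (fun x hx => (hkd x (hKC x hx)).continuousAt.continuousWithinAt)
  have hx0C := hKC x0 hx0
  have hk0 : k x0 ≤ k xc := hmin hxcK
  have hq : a * ‖(x0 - xc) - ⟪z, x0 - xc⟫ • z‖ ^ 2 + b * ⟪z, x0 - xc⟫ ^ 2 ≤ 3 * D := by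
    have h1 := hTq (x0 - xc)
    have h2 := hWle x0 hx0
    simp only [hk, sub_self, map_zero, inner_zero_right] at hk0
    rw [inner_sub_right] at h2
    linarith
  have hint1 : ‖(x0 - xc) - ⟪z, x0 - xc⟫ • z‖ < r := by
    have h1 : 0 ≤ b * ⟪z, x0 - xc⟫ ^ 2 := by positivity
    have h2 : a * ‖(x0 - xc) - ⟪z, x0 - xc⟫ • z‖ ^ 2 < a * r ^ 2 := by linarith
    exact lt_of_pow_lt_pow_left₀ 2 hr.le (lt_of_mul_lt_mul_left h2 ha0.le)
  have hint2 : |⟪z, x0 - xc⟫| < R := by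
    have h1 : 0 ≤ a * ‖(x0 - xc) - ⟪z, x0 - xc⟫ • z‖ ^ 2 := by positivity
    have h2 : b * ⟪z, x0 - xc⟫ ^ 2 < b * R ^ 2 := by linarith
    exact abs_lt_of_sq_lt_sq (lt_of_mul_lt_mul_left h2 hb0.le) hR0.le
  have hloc : IsLocalMin k x0 := by
    filter_upwards [hcn1.continuousAt.eventually_lt continuousAt_const hint1,
      hcn2.continuousAt.eventually_lt continuousAt_const hint2] with x h1 h2
    exact hmin ⟨h1.le, h2.le⟩
  have hTd : HasFDerivAt (fun x => T (x - xc) - g x + g xc) (T - P x0) x0 := by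
    have h1 : HasFDerivAt (fun x => T (x - xc)) T x0 :=
      T.hasFDerivAt.comp x0 ((hasFDerivAt_id x0).sub_const xc)
    exact (h1.sub (hu.hess x0 hx0C).hasFDerivAt).add_const _
  have hhess := fun w => hess_nonneg (k := k) (g := fun x => T (x - xc) - g x + g xc)
    (P := T - P x0) (x := x0)
    (by filter_upwards [hu.cone.isOpen.mem_nhds hx0C] with y hy using hkd y hy) hTd hloc w
  have hdetle := det_mono_of_le (P x0 : Euc (n+1) →ₗ[ℝ] Euc (n+1))
    (T : Euc (n+1) →ₗ[ℝ] Euc (n+1)) (fun v w => hu.symm x0 hx0C v w) (fun v w => hTsymm v w)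
    (fun v hv => hu.pos x0 hx0C v hv)
    (fun v => by
      have := hhess v
      rw [sub_apply, inner_sub_left] at this
      simpa using this)
  rw [hu.det x0 hx0C, hTdet] at hdetle
  have h1 : Real.exp (2 * c1) ≤ Real.exp (2 * u x0) :=
    Real.exp_le_exp.mpr (by linarith [hul x0 hx0])
  have h2 := Real.exp_pos (2 * c1)
  linarith

lemma barrier (hu : Sol n C u g P) {p z : Euc (n+1)} (hp : p ∈ C) (hz : z ∈ closure C)
    (hz0 : z ≠ 0) (M : ℝ) : ∃ t : ℝ, 0 ≤ t ∧ u (p + t • z) < M := by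
  by_contra hcon
  push Not at hcon
  have hn : 0 < ‖z‖ := norm_pos_iff.mpr hz0
  refine hu.barrier_aux hp (hu.cone.smul_closure hz (inv_nonneg.mpr hn.le)) ?_ M ?_
  · simp [norm_smul, hn.ne']
  · intro t ht
    rw [smul_smul]
    exact hcon _ (by positivity)

end Sol

end Barrier

section Conversion

lemma openDual_oCone {m : ℕ} (C : Set (Euc m)) (hC : OCone C) : OCone (openDualCone C) where
  isOpen := by
    have hK : IsCompact (closure C ∩ Metric.sphere (0 : Euc m) 1) :=
      (isCompact_sphere 0 1).inter_left isClosed_closure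
    rw [isOpen_iff_mem_nhds]
    intro y hy
    have hev : ∀ᶠ y' in nhds y, ∀ x ∈ closure C ∩ Metric.sphere (0 : Euc m) 1, 0 < ⟪x, y'⟫ := by
      refine hK.eventually_forall_of_forall_eventually fun x hx => ?_
      have hx0 : x ≠ 0 := by
        rintro rfl
        simpa using hx.2
      have hc : Continuous (fun q : Euc m × Euc m => ⟪q.2, q.1⟫) :=
        continuous_snd.inner continuous_fst
      exact hc.continuousAt.eventually (lt_mem_nhds (hy x hx.1 hx0))
    filter_upwards [hev] with y' hy' x hx hx0
    have hn : 0 < ‖x‖ := norm_pos_iff.mpr hx0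
    have h1 := hy' (‖x‖⁻¹ • x) ⟨hC.smul_closure hx (inv_nonneg.mpr hn.le), by
      simp [norm_smul, hn.ne']⟩
    rw [real_inner_smul_left] at h1
    exact pos_of_mul_pos_right h1 (inv_nonneg.mpr hn.le)
  convex := by
    intro y hy y' hy' a b ha hb hab x hx hx0
    have h1 := hy x hx hx0
    have h2 := hy' x hx hx0
    rw [inner_add_right, real_inner_smul_right, real_inner_smul_right]
    rcases ha.eq_or_lt with h | h
    · have : b = 1 := by linarith
      subst h; subst this; simpa using h2
    · have := mul_pos h h1
      have := mul_nonneg hb h2.le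
      linarith
  smul := by
    intro y hy r hr x hx hx0
    rw [real_inner_smul_right]
    exact mul_pos hr (hy x hx hx0)

lemma exists_sol {n : ℕ} {C : Set (Euc (n+1))} (hC : OCone C) {F : Euc (n+1) → ℝ}
    (hF : IsCanonicalPotential n C F) : ∃ P, Sol n C F (gradient F) P := by
  obtain ⟨hsm, hpd, hdet, hhom, -⟩ := hF
  set L : (Euc (n+1) →L[ℝ] ℝ) →L[ℝ] Euc (n+1) :=
    LinearMap.toContinuousLinearMap
      { toFun := fun l => (InnerProductSpace.toDual ℝ (Euc (n+1))).symm l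
        map_add' := fun a b => map_add _ a b
        map_smul' := fun r a => by simp } with hL
  have hLi : ∀ (l : Euc (n+1) →L[ℝ] ℝ) w, ⟪L l, w⟫ = l w := by
    intro l w
    exact InnerProductSpace.toDual_symm_apply
  set P : Euc (n+1) → Euc (n+1) →L[ℝ] Euc (n+1) := fun x => L ∘L fderiv ℝ (fderiv ℝ F) x with hP
  have hCD : ∀ x ∈ C, ContDiffAt ℝ 2 F x := fun x hx =>
    ((hsm x hx).contDiffAt (hC.isOpen.mem_nhds hx)).of_le (WithTop.coe_le_coe.mpr (le_top : (2 : ℕ∞) ≤ ⊤))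
  have hPi : ∀ x v w, ⟪P x v, w⟫ = fderiv ℝ (fderiv ℝ F) x v w := fun x v w => hLi _ _
  have hM : ∀ x, hessMatrix F x = Matrix.transpose (LinearMap.toMatrix (EuclideanSpace.basisFun (Fin (n+1)) ℝ).toBasis
      (EuclideanSpace.basisFun (Fin (n+1)) ℝ).toBasis (P x : Euc (n+1) →ₗ[ℝ] Euc (n+1))) := by
    intro x
    ext i j
    rw [Matrix.transpose_apply, LinearMap.toMatrix_apply]
    simp only [hessMatrix, iteratedFDeriv_two_apply]
    change fderiv ℝ (fderiv ℝ F) x (EuclideanSpace.single i 1) (EuclideanSpace.single j 1) = _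
    rw [← hPi]
    have h1 := EuclideanSpace.inner_single_right j (1 : ℝ) (P x (EuclideanSpace.single i 1))
    rw [h1]
    simp
  have hsymm : ∀ x ∈ C, ∀ v w, ⟪P x v, w⟫ = ⟪v, P x w⟫ := by
    intro x hx v w
    have h1 : IsSymmSndFDerivAt ℝ F x := (hCD x hx).isSymmSndFDerivAt (by simp)
    rw [real_inner_comm (P x w) v, hPi, hPi]
    exact h1 v w
  refine ⟨P, hC, ?_, ?_, hsymm, ?_, ?_, ?_⟩
  · intro x hx
    have h1 := ((hCD x hx).differentiableAt (by norm_num)).hasGradientAt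
    exact h1.hasFDerivAt
  · intro x hx
    have h1 : ContDiffAt ℝ 1 (fderiv ℝ F) x := (hCD x hx).fderiv_right (by norm_num)
    have h2 := h1.hasStrictFDerivAt (by norm_num)
    exact L.hasStrictFDerivAt.comp x h2
  · intro x hx v hv
    have h1 := (hpd x hx).dotProduct_mulVec_pos (x := v.ofLp) (by simpa using hv)
    have h2 : star v.ofLp ⬝ᵥ (hessMatrix F x).mulVec v.ofLp = ⟪P x v, v⟫ := by
      rw [hM, Matrix.mulVec_transpose, dotProduct_comm, ← Matrix.dotProduct_mulVec]
      have h3 : (LinearMap.toMatrix (EuclideanSpace.basisFun (Fin (n+1)) ℝ).toBasis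
        (EuclideanSpace.basisFun (Fin (n+1)) ℝ).toBasis
        (P x : Euc (n+1) →ₗ[ℝ] Euc (n+1))).mulVec v.ofLp = (P x v).ofLp := by
        have h4 := LinearMap.toMatrix_mulVec_repr (EuclideanSpace.basisFun (Fin (n+1)) ℝ).toBasis
          (EuclideanSpace.basisFun (Fin (n+1)) ℝ).toBasis
          (P x : Euc (n+1) →ₗ[ℝ] Euc (n+1)) v
        have h5 : ∀ w : Euc (n+1),
            ⇑((EuclideanSpace.basisFun (Fin (n + 1)) ℝ).toBasis.repr w) = w.ofLp := by
          intro w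
          ext i
          simp
        rw [h5, h5] at h4
        exact h4
      simp only [star_trivial]
      rw [h3, EuclideanSpace.inner_eq_star_dotProduct]
      simp
    rw [h2] at h1
    exact h1
  · intro x hx
    rw [← hdet x hx, hM, Matrix.det_transpose, LinearMap.det_toMatrix]
  · intro x hx r hr
    have := hhom x hx (Real.log r)
    rwa [Real.exp_log hr] at this

end Conversion

section Legendre

namespace Sol

variable {n : ℕ} {C : Set (Euc (n+1))} {u : Euc (n+1) → ℝ}
    {g : Euc (n+1) → Euc (n+1)} {P : Euc (n+1) → Euc (n+1) →L[ℝ] Euc (n+1)}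

lemma hess_self (h : Sol n C u g P) {x : Euc (n+1)} (hx : x ∈ C) : P x x = -g x := by
  have hl : HasDerivAt (fun s : ℝ => s • x) x 1 := by
    simpa using (hasDerivAt_id (1 : ℝ)).smul_const x
  have hx' : HasFDerivAt g (P x) ((1 : ℝ) • x) := by
    rw [one_smul]; exact (h.hess x hx).hasFDerivAt
  have h1 : HasDerivAt (fun s : ℝ => g (s • x)) (P x x) 1 := by
    have h0 := hx'.comp_hasDerivAt (1 : ℝ) hl
    exact h0
  have h2 : HasDerivAt (fun s : ℝ => s⁻¹ • g x) (-g x) 1 := by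
    have h3 := (hasDerivAt_inv (one_ne_zero (α := ℝ))).smul_const (g x)
    simpa using h3
  have h4 : (fun s : ℝ => g (s • x)) =ᶠ[nhds 1] fun s : ℝ => s⁻¹ • g x := by
    filter_upwards [lt_mem_nhds (zero_lt_one (α := ℝ))] with s hs using h.grad_hom hx hs
  exact h1.unique (h2.congr_of_eventuallyEq h4)

/-- The Legendre dual of a solution is a solution on the dual cone, and it blows up. -/
lemma dual (h : Sol n C u g P) (hne : C.Nonempty) (hb : BlowsUpOnBoundary C u) :
    ∃ (ψ : Euc (n+1) → Euc (n+1)) (Q : Euc (n+1) → Euc (n+1) →L[ℝ] Euc (n+1)),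
      (∀ y ∈ openDualCone C, ψ y ∈ C ∧ -g (ψ y) = y) ∧ (∀ x ∈ C, ψ (-g x) = x) ∧
      Sol n (openDualCone C) (fun y => -u (ψ y)) (fun y => -ψ y) Q ∧
      BlowsUpOnBoundary (openDualCone C) (fun y => -u (ψ y)) := by
  have hex : ∀ y, ∃ x, y ∈ openDualCone C → x ∈ C ∧ -g x = y := by
    intro y
    by_cases hy : y ∈ openDualCone C
    · obtain ⟨x, hx, hxy⟩ := h.surj hne hb hy
      exact ⟨x, fun _ => ⟨hx, hxy⟩⟩
    · exact ⟨0, fun h => absurd h hy⟩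
  choose ψ hψ using hex
  have hψl : ∀ x ∈ C, ψ (-g x) = x := by
    intro x hx
    obtain ⟨h1, h2⟩ := hψ (-g x) (h.neg_grad_mem hx)
    exact h.grad_injOn h1 hx (neg_injective h2)
  have hQ : ∀ y, ∃ Q : Euc (n+1) →L[ℝ] Euc (n+1), y ∈ openDualCone C →
      HasStrictFDerivAt (fun y => -ψ y) Q y ∧ (∀ v, P (ψ y) (Q v) = v) ∧
      LinearMap.det (Q : Euc (n+1) →ₗ[ℝ] Euc (n+1)) = Real.exp (2 * (-u (ψ y))) := by
    intro y
    by_cases hy : y ∈ openDualCone C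
    · obtain ⟨hx, hxy⟩ := hψ y hy
      have hdet : (P (ψ y)).det ≠ 0 := by
        have := h.det _ hx
        have h2 : (P (ψ y)).det = Real.exp (2 * u (ψ y)) := this
        rw [h2]
        exact (Real.exp_pos _).ne'
      set e := (P (ψ y)).toContinuousLinearEquivOfDetNeZero hdet with he
      have hec : (e : Euc (n+1) →L[ℝ] Euc (n+1)) = P (ψ y) :=
        ContinuousLinearMap.coe_toContinuousLinearEquivOfDetNeZero _ _
      have h1 : HasStrictFDerivAt g (e : Euc (n+1) →L[ℝ] Euc (n+1)) (ψ y) := by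
        rw [hec]; exact h.hess _ hx
      have h2 : HasStrictFDerivAt (fun w => ψ (-w))
          (e.symm : Euc (n+1) →L[ℝ] Euc (n+1)) (g (ψ y)) := by
        refine h1.to_local_left_inverse ?_
        filter_upwards [h.cone.isOpen.mem_nhds hx] with x hx using hψl x hx
      have h2' : HasStrictFDerivAt (fun w => ψ (-w))
          (e.symm : Euc (n+1) →L[ℝ] Euc (n+1)) (-y) := by
        have : g (ψ y) = -y := by rw [← hxy, neg_neg, hxy]
        rwa [this] at h2
      have h3 := (h2'.comp y (hasStrictFDerivAt_id y).neg).neg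
      refine ⟨e.symm, fun _ => ⟨?_, ?_, ?_⟩⟩
      · have h4 : (fun y => -ψ y) = -((fun w => ψ (-w)) ∘ (-id)) := by
          funext w
          simp
        rw [h4]
        refine h3.congr_fderiv ?_
        ext v
        simp
      · intro v
        rw [← hec]
        exact e.apply_symm_apply v
      · have h5 := e.det_coe_symm
        have h6 : LinearMap.det ((e.symm : Euc (n+1) →L[ℝ] Euc (n+1)) :
          Euc (n+1) →ₗ[ℝ] Euc (n+1)) = ((e : Euc (n+1) →L[ℝ] Euc (n+1)).det)⁻¹ := h5
        rw [h6, hec]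
        have h7 : (P (ψ y)).det = Real.exp (2 * u (ψ y)) := h.det _ hx
        rw [h7, ← Real.exp_neg]
        congr 1
        ring
    · exact ⟨0, fun h => absurd h hy⟩
  choose Q hQ using hQ
  refine ⟨ψ, Q, hψ, hψl, ?_, ?_⟩
  · refine ⟨openDual_oCone C h.cone, ?_, fun y hy => (hQ y hy).1, ?_, ?_,
      fun y hy => (hQ y hy).2.2, ?_⟩
    · intro y hy
      obtain ⟨hx, hxy⟩ := hψ y hy
      have h1 : HasFDerivAt ψ (-Q y) y := by
        have h0 := (hQ y hy).1.hasFDerivAt.neg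
        have h00 : (-fun y => -ψ y) = ψ := by
          funext w
          simp
        rwa [h00] at h0
      have h2 := ((h.grad _ hx).comp y h1).neg
      refine h2.congr_fderiv ?_
      ext v
      have h3 : ⟪g (ψ y), Q y v⟫ = -⟪ψ y, v⟫ := by
        have h4 : g (ψ y) = -(P (ψ y) (ψ y)) := by rw [h.hess_self hx, neg_neg]
        rw [h4, inner_neg_left, h.symm _ hx, (hQ y hy).2.1]
      change -⟪g (ψ y), -(Q y v)⟫ = ⟪-ψ y, v⟫
      rw [inner_neg_right, inner_neg_left, h3]
      ring
    · intro y hy v w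
      have h1 := h.symm _ (hψ y hy).1 (Q y v) (Q y w)
      rw [(hQ y hy).2.1, (hQ y hy).2.1] at h1
      exact h1.symm
    · intro y hy v hv
      have h0 : Q y v ≠ 0 := by
        intro h0
        have := (hQ y hy).2.1 v
        rw [h0, map_zero] at this
        exact hv this.symm
      have h1 := h.pos _ (hψ y hy).1 (Q y v) h0
      rw [(hQ y hy).2.1, real_inner_comm] at h1
      exact h1
    · intro y hy r hr
      obtain ⟨hx, hxy⟩ := hψ y hy
      have h1 := h.cone.smul _ hx r⁻¹ (inv_pos.mpr hr)
      have h2 : ψ (r • y) = r⁻¹ • ψ y := by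
        have h3 := hψl _ h1
        rwa [h.grad_hom hx (inv_pos.mpr hr), inv_inv, ← smul_neg, hxy] at h3
      change -u (ψ (r • y)) = -u (ψ y) - (n+1) * Real.log r
      rw [h2, h.hom _ hx _ (inv_pos.mpr hr), Real.log_inv]
      ring
  · intro y0 hy0 y hy hlim
    obtain ⟨p, hp⟩ := hne
    have hopen := (openDual_oCone C h.cone).isOpen
    have hnot : y0 ∉ openDualCone C := by
      rw [hopen.frontier_eq] at hy0
      exact hy0.2
    have hz : ∃ z ∈ closure C, z ≠ 0 ∧ ⟪z, y0⟫ ≤ 0 := by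
      by_contra hcon
      push Not at hcon
      exact hnot fun z hz hz0 => hcon z hz hz0
    obtain ⟨z, hz, hz0, hzy⟩ := hz
    rw [Filter.tendsto_atTop]
    intro M
    obtain ⟨t, ht, htM⟩ := h.barrier hp hz hz0 (-M - ⟪p, y0⟫)
    have hxC : p + t • z ∈ C := h.cone.add_mem hp (h.cone.smul_closure hz ht)
    have hc : Filter.Tendsto (fun k => -⟪p + t • z, y k⟫ - u (p + t • z)) Filter.atTop
        (nhds (-⟪p + t • z, y0⟫ - u (p + t • z))) :=
      ((tendsto_const_nhds.inner hlim).neg).sub_const _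
    have hgt : M < -⟪p + t • z, y0⟫ - u (p + t • z) := by
      rw [inner_add_left, real_inner_smul_left]
      have := mul_nonneg ht (neg_nonneg.mpr hzy)
      linarith
    filter_upwards [hc.eventually (lt_mem_nhds hgt)] with k hk
    obtain ⟨hx, hxy⟩ := hψ (y k) (hy k)
    have h1 := h.grad_le hx hxC
    rw [inner_sub_right, h.grad_self hx] at h1
    have h2 : ⟪g (ψ (y k)), p + t • z⟫ = -⟪p + t • z, y k⟫ := by
      rw [← inner_neg_right, real_inner_comm]
      congr 1
      rw [← hxy, neg_neg, hxy]
    rw [h2] at h1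
    have hn : (0 : ℝ) < n + 1 := by positivity
    linarith

end Sol

end Legendre
/-- The canonical potentials of a proper open convex cone and of its dual cone are
exchanged by minus the gradient maps, which are mutually inverse bijections. -/
theorem canonical_potential_duality
    (n : ℕ) (Ω : Set (Euc (n + 1))) (hΩ : IsOpenProperConvexCone Ω)
    (F : Euc (n + 1) → ℝ) (hF : IsCanonicalPotential n Ω F)
    (Fd : Euc (n + 1) → ℝ) (hFd : IsCanonicalPotential n (openDualCone Ω) Fd) :
    (∀ x ∈ Ω,
      F x + Fd (-gradient F x) = 0 ∧ -gradient Fd (-gradient F x) = x) ∧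
    Set.BijOn (fun x => -gradient F x) Ω (openDualCone Ω) ∧
    Set.BijOn (fun y => -gradient Fd y) (openDualCone Ω) Ω := by
  obtain ⟨hne, hopen, hconv, hsc, -⟩ := hΩ
  have hC : OCone Ω := ⟨hopen, hconv, fun x hx r hr => by
    have := hsc x hx (Real.log r)
    rwa [Real.exp_log hr] at this⟩
  obtain ⟨P, hS⟩ := exists_sol hC hF
  obtain ⟨P', hS'⟩ := exists_sol (openDual_oCone Ω hC) hFd
  obtain ⟨ψ, Q, hψ, hψl, hD, hDb⟩ := hS.dual hne hF.2.2.2.2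
  obtain ⟨x0, hx0⟩ := hne
  have hp : -gradient F x0 ∈ openDualCone Ω := hS.neg_grad_mem hx0
  have hl : ∀ z ∈ closure (openDualCone Ω), z ≠ 0 → 0 < ⟪x0, z⟫ := by
    intro z hz hz0
    have hcl : ∀ x ∈ Ω, 0 ≤ ⟪x, z⟫ := by
      intro x hx
      have hc : IsClosed {z : Euc (n+1) | 0 ≤ ⟪x, z⟫} :=
        isClosed_le continuous_const (continuous_const.inner continuous_id)
      exact closure_minimal
        (fun y hy => (hy x (subset_closure hx) (hS.ne_zero hx)).le) hc hz
    have hct : Filter.Tendsto (fun s : ℝ => x0 - s • z) (nhdsWithin 0 (Set.Ioi 0)) (nhds x0) := by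
      have h1 : Continuous (fun s : ℝ => x0 - s • z) :=
        continuous_const.sub (continuous_id.smul continuous_const)
      have h2 := h1.tendsto 0
      rw [zero_smul, sub_zero] at h2
      exact h2.mono_left nhdsWithin_le_nhds
    obtain ⟨s, hs, hs0⟩ := ((hct.eventually (hopen.mem_nhds hx0)).and
      self_mem_nhdsWithin).exists
    have h1 := hcl _ hs
    rw [inner_sub_left, real_inner_smul_left] at h1
    have h2 : 0 < s * ⟪z, z⟫ := mul_pos hs0 (real_inner_self_pos.mpr hz0)
    linarith
  have hEq : ∀ y ∈ openDualCone Ω, Fd y = -F (ψ y) := fun y hy =>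
    le_antisymm (hD.compare hS' hDb hp hl y hy) (hS'.compare hD hFd.2.2.2.2 hp hl y hy)
  have hG : ∀ y ∈ openDualCone Ω, -gradient Fd y = ψ y := by
    intro y hy
    have h1 := hS'.grad y hy
    have h2 : HasFDerivAt Fd (innerSL ℝ (-ψ y)) y := by
      refine (hD.grad y hy).congr_of_eventuallyEq ?_
      filter_upwards [hD.cone.isOpen.mem_nhds hy] with w hw using hEq w hw
    have h3 := h1.unique h2
    have h4 : gradient Fd y = -ψ y := by
      refine ext_inner_right ℝ fun w => ?_
      exact congrArg (fun l : Euc (n+1) →L[ℝ] ℝ => l w) h3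
    rw [h4, neg_neg]
  have hm : ∀ x ∈ Ω, -gradient F x ∈ openDualCone Ω := fun x hx => hS.neg_grad_mem hx
  refine ⟨fun x hx => ⟨?_, ?_⟩, ⟨fun x hx => hm x hx, ?_, ?_⟩, ⟨?_, ?_, ?_⟩⟩
  · rw [hEq _ (hm x hx), hψl x hx, add_neg_cancel]
  · rw [hG _ (hm x hx), hψl x hx]
  · intro x hx y hy hxy
    exact hS.grad_injOn hx hy (neg_injective hxy)
  · intro y hy
    exact ⟨ψ y, (hψ y hy).1, (hψ y hy).2⟩
  · intro y hy
    have := (hψ y hy).1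
    rw [← hG y hy] at this
    exact this
  · intro y hy w hw hyw
    have h1 : ψ y = ψ w := by rw [← hG y hy, ← hG w hw]; exact hyw
    rw [← (hψ y hy).2, ← (hψ w hw).2, h1]
  · intro x hx
    exact ⟨-gradient F x, hm x hx, by
      change -gradient Fd (-gradient F x) = x
      rw [hG _ (hm x hx), hψl x hx]⟩
end
end

section
/- Let Ω ⊆ ℝ^{n+1} be a nonempty proper open convex cone with open dual cone Ω*, let F_Ω be a canonical potential of Ω, and let F_{Ω*} be a canonical potential of Ω*. Then for every x ∈ Ω the Hessian of F_{Ω*} at the point −∇F_Ω(x) is the inverse of the Hessian of F_Ω at x: D²F_{Ω*}(−∇F_Ω(x)) = (D²F_Ω(x))⁻¹ (as symmetric matrices with respect to the standard coordinates). In particular the map x ↦ −∇F_Ω(x) is an isometry from Ω equipped with the Hessian metric D²F_Ω onto Ω* equipped with the Hessian metric D²F_{Ω*}. -/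
open scoped RealInnerProductSpace

noncomputable section

/-! ### Linear algebra -/

theorem one_le_det_one_add {m : ℕ} {P : Matrix (Fin m) (Fin m) ℝ} (hP : P.PosSemidef) :
    1 ≤ (1 + P).det := by
  have hQ : (1 + P).IsHermitian := Matrix.isHermitian_one.add hP.1
  rw [hQ.det_eq_prod_eigenvalues]
  have : ∀ i, (1:ℝ) ≤ hQ.eigenvalues i := by
    intro i
    rw [hQ.eigenvalues_eq i, Matrix.add_mulVec, Matrix.one_mulVec, dotProduct_add]
    have h1 := hP.dotProduct_mulVec_nonneg (hQ.eigenvectorBasis i).ofLp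
    have h2 : star (hQ.eigenvectorBasis i).ofLp ⬝ᵥ (hQ.eigenvectorBasis i).ofLp = 1 := by
      have := hQ.eigenvectorBasis.orthonormal.1 i
      have h3 := real_inner_self_eq_norm_sq (hQ.eigenvectorBasis i)
      rw [this, EuclideanSpace.inner_eq_star_dotProduct, dotProduct_comm] at h3
      simpa using h3
    rw [h2]
    simpa using h1
  calc (1:ℝ) = ∏ i : Fin m, (1:ℝ) := by simp
    _ ≤ _ := Finset.prod_le_prod (by intros; norm_num) (fun i _ => by simpa using this i)

theorem matrix_det_mono {m : ℕ} {A B : Matrix (Fin m) (Fin m) ℝ} (hA : A.PosSemidef)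
    (hBA : (B - A).PosSemidef) : A.det ≤ B.det := by
  have hB : B.PosSemidef := by
    have := hA.add hBA
    rwa [add_sub_cancel] at this
  by_cases h0 : A.det = 0
  · rw [h0]; exact hB.det_nonneg
  obtain ⟨C, rfl⟩ : ∃ C : Matrix (Fin m) (Fin m) ℝ, A = C.conjTranspose * C := by
    open scoped MatrixOrder in
    have := CStarAlgebra.nonneg_iff_eq_star_mul_self.mp (Matrix.nonneg_iff_posSemidef.mpr hA)
    simpa [Matrix.star_eq_conjTranspose] using this
  have hC : IsUnit C.det := by
    rw [Matrix.det_mul] at h0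
    exact isUnit_iff_ne_zero.mpr (right_ne_zero_of_mul h0)
  have hP := hBA.conjTranspose_mul_mul_same C⁻¹
  have h1 := one_le_det_one_add hP
  have h2 : B = C.conjTranspose *
      (1 + C⁻¹.conjTranspose * (B - C.conjTranspose * C) * C⁻¹) * C := by
    have e1 : C⁻¹ * C = 1 := Matrix.nonsing_inv_mul _ hC
    have e2 : C.conjTranspose * C⁻¹.conjTranspose = 1 := by
      rw [← Matrix.conjTranspose_mul, e1, Matrix.conjTranspose_one]
    have : C.conjTranspose *
      (1 + C⁻¹.conjTranspose * (B - C.conjTranspose * C) * C⁻¹) * C =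
       C.conjTranspose * C + (C.conjTranspose * C⁻¹.conjTranspose) * (B - C.conjTranspose * C)
        * (C⁻¹ * C) := by
      noncomm_ring
    rw [this, e1, e2]; simp
  conv_rhs => rw [h2]
  rw [Matrix.det_mul, Matrix.det_mul, Matrix.det_mul, Matrix.det_conjTranspose]
  simp only [star_trivial]
  nlinarith [mul_self_nonneg C.det]

theorem det_mono {m : ℕ} {S T : Euc m →ₗ[ℝ] Euc m} (hS : S.IsSymmetric) (hT : T.IsSymmetric)
    (h0 : ∀ v, 0 ≤ ⟪S v, v⟫) (h1 : ∀ v, ⟪S v, v⟫ ≤ ⟪T v, v⟫) :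
    LinearMap.det S ≤ LinearMap.det T := by
  let b := EuclideanSpace.basisFun (Fin m) ℝ
  rw [← LinearMap.det_toMatrix b.toBasis, ← LinearMap.det_toMatrix b.toBasis]
  apply matrix_det_mono
  · rw [LinearMap.posSemidef_toMatrix_iff]
    exact ⟨hS, fun v => by simpa using h0 v⟩
  · rw [← map_sub, LinearMap.posSemidef_toMatrix_iff]
    exact ⟨hT.sub hS, fun v => by simpa [inner_sub_left] using h1 v⟩

theorem det_adjoint' {m : ℕ} (S : Euc m →ₗ[ℝ] Euc m) :
    LinearMap.det (LinearMap.adjoint S) = LinearMap.det S := by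
  let b := EuclideanSpace.basisFun (Fin m) ℝ
  rw [← LinearMap.det_toMatrix b.toBasis, ← LinearMap.det_toMatrix b.toBasis]
  rw [LinearMap.toMatrix_adjoint, Matrix.det_conjTranspose]
  simp

/-- Determinant comparison after a linear change of variables. -/
theorem det_mono_comp {m : ℕ} {S T L : Euc m →ₗ[ℝ] Euc m} (hS : S.IsSymmetric)
    (hT : T.IsSymmetric)
    (h0 : ∀ v, 0 ≤ ⟪S v, v⟫) (h1 : ∀ v, ⟪S (L v), L v⟫ ≤ ⟪T v, v⟫) :
    LinearMap.det S * (LinearMap.det L) ^ 2 ≤ LinearMap.det T := by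
  have key : ∀ v w, ⟪(LinearMap.adjoint L ∘ₗ S ∘ₗ L) v, w⟫ = ⟪S (L v), L w⟫ := by
    intro v w
    simp [LinearMap.adjoint_inner_left]
  have := det_mono (S := LinearMap.adjoint L ∘ₗ S ∘ₗ L) (T := T) ?_ hT ?_ ?_
  · rw [LinearMap.det_comp, LinearMap.det_comp, det_adjoint'] at this
    linarith [this]
  · intro v w
    rw [key, hS, ← real_inner_comm (L v), ← key w v]
    exact real_inner_comm _ _
  · intro v; rw [key]; exact h0 _
  · intro v; rw [key]; exact h1 v

theorem det_joint {m : ℕ} {S T A : Euc m →ₗ[ℝ] Euc m} (hS : S.IsSymmetric)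
    (hT : T.IsSymmetric) (hS0 : ∀ v, v ≠ 0 → 0 < ⟪S v, v⟫) (hSd : 0 < LinearMap.det S)
    (h1 : ∀ v w, 0 ≤ ⟪S v, v⟫ + ⟪T w, w⟫ + 2 * ⟪v, A w⟫) :
    (LinearMap.det A) ^ 2 ≤ LinearMap.det S * LinearMap.det T := by
  have hinj : Function.Injective S := by
    rw [← LinearMap.ker_eq_bot, LinearMap.ker_eq_bot']
    intro v hv
    by_contra h
    have := hS0 v h
    rw [hv] at this
    simp at this
  let e := LinearEquiv.ofInjectiveEndo S hinj
  let K : Euc m →ₗ[ℝ] Euc m := e.symm.toLinearMap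
  have hSK : ∀ v, S (K v) = v := fun v => e.apply_symm_apply v
  have hSK' : S ∘ₗ K = LinearMap.id := by ext1 v; exact hSK v
  have hdet : LinearMap.det S * LinearMap.det K = 1 := by
    rw [← LinearMap.det_comp, hSK', LinearMap.det_id]
  have hK : K.IsSymmetric := by
    intro v w
    have := hS (K v) (K w)
    rw [hSK, hSK] at this
    exact this.symm
  have := det_mono_comp (S := K) (T := T) (L := A) hK hT ?_ ?_
  · calc (LinearMap.det A) ^ 2 = LinearMap.det S * (LinearMap.det K * (LinearMap.det A) ^ 2) := by
          rw [← mul_assoc, hdet, one_mul]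
      _ ≤ _ := by gcongr
  · intro v
    by_cases h : K v = 0
    · simp [h]
    · have := hS0 _ h
      rw [hSK, real_inner_comm] at this
      exact this.le
  · intro w
    have := h1 (-(K (A w))) w
    simp only [map_neg, inner_neg_left, inner_neg_right, hSK, neg_neg] at this
    have h2 := real_inner_comm (K (A w)) (A w)
    linarith

theorem posSemi_of_le_smul {m : ℕ} {S L : Euc m →ₗ[ℝ] Euc m} {c : ℝ} (hS : S.IsSymmetric)
    (h0 : ∀ v, 0 ≤ ⟪S v, v⟫) (h1 : ∀ v, ⟪S (L v), L v⟫ ≤ c * ‖v‖ ^ 2) :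
    LinearMap.det S * (LinearMap.det L) ^ 2 ≤ c ^ m := by
  have := det_mono_comp (T := c • LinearMap.id) hS ?_ h0 (L := L) ?_
  · simpa using this
  · intro v w; simp [inner_smul_left, inner_smul_right]
  · intro v
    simpa [inner_smul_left] using h1 v

/-! ### Potentials in operator form -/

/-- A potential together with its gradient and Hessian operator. -/
structure Pot (m : ℕ) (Ω : Set (Euc m)) (F : Euc m → ℝ) (G : Euc m → Euc m)
    (H : Euc m → Euc m →L[ℝ] Euc m) : Prop where
  hm : 0 < m
  isOpen : IsOpen Ω
  convex : Convex ℝ Ω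
  cone : ∀ x ∈ Ω, ∀ t : ℝ, 0 < t → t • x ∈ Ω
  grad : ∀ x ∈ Ω, HasFDerivAt F (innerSL ℝ (G x)) x
  hess : ∀ x ∈ Ω, HasFDerivAt G (H x) x
  contH : ContinuousOn H Ω
  symm : ∀ x ∈ Ω, ∀ v w, ⟪H x v, w⟫ = ⟪v, H x w⟫
  pos : ∀ x ∈ Ω, ∀ v, v ≠ 0 → 0 < ⟪H x v, v⟫
  det : ∀ x ∈ Ω, LinearMap.det (H x : Euc m →ₗ[ℝ] Euc m) = Real.exp (2 * F x)
  hom : ∀ x ∈ Ω, ∀ t : ℝ, 0 < t → F (t • x) = F x - m * Real.log t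
  blow : BlowsUpOnBoundary Ω F

namespace Pot

variable {m : ℕ} {Ω : Set (Euc m)} {F : Euc m → ℝ} {G : Euc m → Euc m}
    {H : Euc m → Euc m →L[ℝ] Euc m}

theorem nonneg (P : Pot m Ω F G H) {x : Euc m} (hx : x ∈ Ω) (v : Euc m) : 0 ≤ ⟪H x v, v⟫ := by
  by_cases h : v = 0
  · simp [h]
  · exact (P.pos x hx v h).le

theorem contF (P : Pot m Ω F G H) {x : Euc m} (hx : x ∈ Ω) : ContinuousAt F x :=
  (P.grad x hx).continuousAt

theorem contG (P : Pot m Ω F G H) {x : Euc m} (hx : x ∈ Ω) : ContinuousAt G x :=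
  (P.hess x hx).continuousAt

theorem zero_notMem (P : Pot m Ω F G H) : (0 : Euc m) ∉ Ω := by
  intro h
  have := P.hom 0 h (Real.exp 1) (Real.exp_pos 1)
  have hm := P.hm
  have hm' : (0:ℝ) < m := by exact_mod_cast hm
  rw [smul_zero, Real.log_exp] at this
  linarith

theorem grad_hom (P : Pot m Ω F G H) {x : Euc m} (hx : x ∈ Ω) {t : ℝ} (ht : 0 < t) :
    G (t • x) = t⁻¹ • G x := by
  have h1 : HasFDerivAt (fun z : Euc m => F (t • z))
      ((innerSL ℝ (G (t • x))).comp (t • ContinuousLinearMap.id ℝ (Euc m))) x := by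
    have := P.grad (t • x) (P.cone x hx t ht)
    exact HasFDerivAt.comp x (g := F) (f := fun z => t • z) this
      ((hasFDerivAt_id x).const_smul t)
  have h2 : HasFDerivAt (fun z : Euc m => F (t • z)) (innerSL ℝ (G x)) x := by
    refine ((P.grad x hx).sub_const (m * Real.log t)).congr_of_eventuallyEq ?_
    filter_upwards [P.isOpen.mem_nhds hx] with z hz
    exact P.hom z hz t ht
  have h3 := h1.unique h2
  have h4 : t • G (t • x) = G x := by
    refine ext_inner_right ℝ fun v => ?_
    have := congrArg (fun f => f v) h3
    simpa [inner_smul_left, inner_smul_right] using this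
  rw [← h4, smul_smul, inv_mul_cancel₀ ht.ne', one_smul]

theorem euler (P : Pot m Ω F G H) {x : Euc m} (hx : x ∈ Ω) : ⟪G x, x⟫ = -m := by
  have h1 : HasDerivAt (fun s : ℝ => F (s • x)) (⟪G x, x⟫) 1 := by
    have h : HasDerivAt (fun s : ℝ => s • x) ((1:ℝ) • x) 1 := (hasDerivAt_id (1:ℝ)).smul_const x
    have h' := P.grad x hx
    have := HasFDerivAt.comp_hasDerivAt_of_eq (1:ℝ) h' h (by simp)
    simp only [one_smul, innerSL_apply_apply] at this
    exact this
  have h2 : HasDerivAt (fun s : ℝ => F (s • x)) (-m) 1 := by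
    have := ((Real.hasDerivAt_log (one_ne_zero)).const_mul (m:ℝ)).const_sub (F x)
    simp only [inv_one, mul_one] at this
    refine this.congr_of_eventuallyEq ?_
    filter_upwards [lt_mem_nhds (zero_lt_one (α := ℝ))] with s hs
    exact P.hom x hx s hs
  exact h1.unique h2

theorem euler2 (P : Pot m Ω F G H) {x : Euc m} (hx : x ∈ Ω) : H x x = - G x := by
  have h1 : HasDerivAt (fun s : ℝ => G (s • x)) (H x x) 1 := by
    have h : HasDerivAt (fun s : ℝ => s • x) ((1:ℝ) • x) 1 := (hasDerivAt_id (1:ℝ)).smul_const x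
    have := HasFDerivAt.comp_hasDerivAt_of_eq (1:ℝ) (P.hess x hx) h (by simp)
    simp only [one_smul, innerSL_apply_apply] at this
    exact this
  have h2 : HasDerivAt (fun s : ℝ => G (s • x)) (- G x) 1 := by
    have := (hasDerivAt_inv (one_ne_zero (α := ℝ))).smul_const (G x)
    simp only [one_pow, inv_one, neg_smul, one_smul] at this
    refine this.congr_of_eventuallyEq ?_
    filter_upwards [lt_mem_nhds (zero_lt_one (α := ℝ))] with s hs
    exact P.grad_hom hx hs
  exact h1.unique h2

theorem line_deriv (P : Pot m Ω F G H) {x v : Euc m} {s : ℝ} (hx : x + s • v ∈ Ω) :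
    HasDerivAt (fun s : ℝ => F (x + s • v)) ⟪G (x + s • v), v⟫ s := by
  have h : HasDerivAt (fun s : ℝ => x + s • v) ((1:ℝ) • v) s :=
    ((hasDerivAt_id s).smul_const v).const_add x
  have := HasFDerivAt.comp_hasDerivAt_of_eq s (P.grad _ hx) h rfl
  simp only [one_smul, innerSL_apply_apply] at this
  exact this

theorem line_derivG (P : Pot m Ω F G H) {x v : Euc m} {s : ℝ} (hx : x + s • v ∈ Ω) :
    HasDerivAt (fun s : ℝ => G (x + s • v)) (H (x + s • v) v) s := by
  have h : HasDerivAt (fun s : ℝ => x + s • v) ((1:ℝ) • v) s :=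
    ((hasDerivAt_id s).smul_const v).const_add x
  have := HasFDerivAt.comp_hasDerivAt_of_eq s (P.hess _ hx) h rfl
  simp only [one_smul, innerSL_apply_apply] at this
  exact this

theorem line_deriv2 (P : Pot m Ω F G H) {x v : Euc m} {s : ℝ} (hx : x + s • v ∈ Ω) :
    HasDerivAt (fun s : ℝ => ⟪G (x + s • v), v⟫) ⟪H (x + s • v) v, v⟫ s := by
  have := (P.line_derivG hx).inner ℝ (hasDerivAt_const s v)
  simpa using this

theorem tangent_le (P : Pot m Ω F G H) {x z : Euc m} (hx : x ∈ Ω) (hz : z ∈ Ω) :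
    F x + ⟪G x, z - x⟫ ≤ F z := by
  set v := z - x with hv
  have hmem : ∀ s ∈ Set.Icc (0:ℝ) 1, x + s • v ∈ Ω := fun s hs =>
    P.convex.add_smul_sub_mem hx hz hs
  obtain ⟨c, hc, hc'⟩ := exists_hasDerivAt_eq_slope (fun s : ℝ => F (x + s • v))
    (fun s => ⟪G (x + s • v), v⟫) zero_lt_one
    (fun s hs => (P.line_deriv (hmem s hs)).continuousAt.continuousWithinAt)
    (fun s hs => P.line_deriv (hmem s (Set.Ioo_subset_Icc_self hs)))
  have hsub : ∀ s ∈ Set.Icc (0:ℝ) c, s ∈ Set.Icc (0:ℝ) 1 := fun s hs =>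
    ⟨hs.1, hs.2.trans hc.2.le⟩
  obtain ⟨d, hd, hd'⟩ := exists_hasDerivAt_eq_slope (fun s : ℝ => ⟪G (x + s • v), v⟫)
    (fun s => ⟪H (x + s • v) v, v⟫) hc.1
    (fun s hs => (P.line_deriv2 (hmem s (hsub s hs))).continuousAt.continuousWithinAt)
    (fun s hs => P.line_deriv2 (hmem s (hsub s (Set.Ioo_subset_Icc_self hs))))
  have h0 := P.nonneg (hmem d (hsub d (Set.Ioo_subset_Icc_self hd))) v
  rw [hd'] at h0
  simp only [zero_smul, add_zero, one_smul, sub_zero, div_one] at hc' h0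
  have h1 : 0 ≤ ⟪G (x + c • v), v⟫ - ⟪G x, v⟫ := by
    by_contra hneg
    push Not at hneg
    exact absurd h0 (not_le.mpr (div_neg_of_neg_of_pos hneg hc.1))
  have h2 : x + v = z := by rw [hv]; abel
  rw [h2] at hc'
  linarith

theorem smul_mem_closure (P : Pot m Ω F G H) {z : Euc m} (hz : z ∈ closure Ω) {t : ℝ}
    (ht : 0 < t) : t • z ∈ closure Ω :=
  map_mem_closure (continuous_const_smul t) hz (fun x hx => P.cone x hx t ht)

theorem add_mem (P : Pot m Ω F G H) {x z : Euc m} (hx : x ∈ Ω) (hz : z ∈ closure Ω) {s : ℝ}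
    (hs : 0 ≤ s) : x + s • z ∈ Ω := by
  rcases hs.eq_or_lt with rfl | hs
  · simpa using hx
  have h1 : (2:ℝ) • x ∈ interior Ω := by
    rw [P.isOpen.interior_eq]; exact P.cone x hx 2 (by norm_num)
  have h2 : (2 * s) • z ∈ closure Ω := P.smul_mem_closure hz (by positivity)
  have := P.convex.combo_interior_closure_mem_interior h1 h2 (a := 1/2) (b := 1/2)
    (by norm_num) (by norm_num) (by norm_num)
  rw [P.isOpen.interior_eq, smul_smul, smul_smul] at this
  convert this using 2
  · norm_num
  · congr 1; ring

theorem bddBelow (P : Pot m Ω F G H) (R : ℝ) : ∃ C : ℝ, ∀ x ∈ Ω, ‖x‖ ≤ R → C ≤ F x := by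
  by_contra hcon
  push Not at hcon
  choose x hx using fun k : ℕ => hcon (-(k:ℝ))
  have hb : ∀ k, x k ∈ Metric.closedBall (0 : Euc m) R := fun k => by
    simpa using (hx k).2.1
  obtain ⟨a, -, φ, hφ, hlim⟩ := (isCompact_closedBall (0 : Euc m) R).tendsto_subseq hb
  have hneg : Filter.Tendsto (fun k => F (x (φ k))) Filter.atTop Filter.atBot := by
    refine Filter.tendsto_atBot_mono (fun k => (hx (φ k)).2.2.le) ?_
    exact Filter.tendsto_neg_atTop_atBot.comp
      (tendsto_natCast_atTop_atTop.comp hφ.tendsto_atTop)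
  have hcl : a ∈ closure Ω := mem_closure_of_tendsto hlim (Filter.Eventually.of_forall
    fun k => (hx (φ k)).1)
  by_cases ha : a ∈ Ω
  · exact not_tendsto_nhds_of_tendsto_atBot hneg _ ((P.contF ha).tendsto.comp hlim)
  · have hf : a ∈ frontier Ω := by
      rw [P.isOpen.frontier_eq]; exact ⟨hcl, ha⟩
    have := P.blow a hf _ (fun k => (hx (φ k)).1) hlim
    exact (Filter.Tendsto.not_tendsto hneg (Filter.disjoint_atBot_atTop)) this

/-- a limit of points of `Ω` along which `F` is bounded above belongs to `Ω`. -/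
theorem mem_of_tendsto (P : Pot m Ω F G H) {x : ℕ → Euc m} (hx : ∀ k, x k ∈ Ω) {a : Euc m}
    (ha : Filter.Tendsto x Filter.atTop (nhds a)) {C : ℝ} (hC : ∀ k, F (x k) ≤ C) : a ∈ Ω := by
  by_contra hn
  have hf : a ∈ frontier Ω := by
    rw [P.isOpen.frontier_eq]
    exact ⟨mem_closure_of_tendsto ha (Filter.Eventually.of_forall hx), hn⟩
  have := P.blow a hf x hx ha
  obtain ⟨k, hk⟩ := (this.eventually (Filter.eventually_gt_atTop C)).exists
  exact absurd (hC k) (not_le.mpr hk)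

end Pot

/-! ### Interior estimate -/

theorem second_test {φ φ' : ℝ → ℝ} {c : ℝ} (h1 : ∀ᶠ s in nhds (0:ℝ), HasDerivAt φ (φ' s) s)
    (h2 : HasDerivAt φ' c 0) (h3 : IsLocalMin φ 0) : 0 ≤ c := by
  by_contra hc
  push Not at hc
  have h0 : φ' 0 = 0 := h3.hasDerivAt_eq_zero h1.self_of_nhds
  have h4 := hasDerivAt_iff_tendsto_slope.mp h2
  have h5 : ∀ᶠ s in nhdsWithin (0:ℝ) {0}ᶜ, slope φ' 0 s < 0 := h4.eventually (gt_mem_nhds hc)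
  rw [eventually_nhdsWithin_iff] at h5
  obtain ⟨δ, hδ, hb⟩ := Metric.eventually_nhds_iff.mp (h1.and (h5.and h3))
  have hmem : ∀ s ∈ Set.Icc (0:ℝ) (δ/2), dist s 0 < δ := by
    intro s hs
    rw [Real.dist_eq, sub_zero, abs_of_nonneg hs.1]
    linarith [hs.2]
  obtain ⟨ξ, hξ, hξ'⟩ := exists_hasDerivAt_eq_slope φ φ' (half_pos hδ)
    (fun s hs => (hb (hmem s hs)).1.continuousAt.continuousWithinAt)
    (fun s hs => (hb (hmem s (Set.Ioo_subset_Icc_self hs))).1)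
  have h6 := (hb (hmem ξ (Set.Ioo_subset_Icc_self hξ))).2.1 (by simpa using hξ.1.ne')
  rw [slope_def_field, h0, sub_zero, sub_zero] at h6
  have h7 : φ' ξ < 0 := by
    by_contra h
    push Not at h
    exact absurd h6 (not_lt.mpr (div_nonneg h hξ.1.le))
  have h8 := (hb (hmem (δ/2) ⟨(half_pos hδ).le, le_rfl⟩)).2.2
  rw [hξ', sub_zero] at h7
  have : φ (δ/2) - φ 0 < 0 := by
    by_contra h
    push Not at h
    exact absurd h7 (not_lt.mpr (div_nonneg h (half_pos hδ).le))
  linarith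

namespace Pot

variable {m : ℕ} {Ω : Set (Euc m)} {F : Euc m → ℝ} {G : Euc m → Euc m}
    {H : Euc m → Euc m →L[ℝ] Euc m}

theorem interior_est (P : Pot m Ω F G H) (c : Euc m) (L : Euc m →ₗ[ℝ] Euc m)
    (hL : ∀ v : Euc m, ‖v‖ ≤ 1 → c + L v ∈ Ω) :
    Real.exp (F c) ^ 2 * (LinearMap.det L) ^ 2 ≤ (4 * m : ℝ) ^ m := by
  have hLc : Continuous L := L.continuous_of_finiteDimensional
  have hm : (0:ℝ) < m := by exact_mod_cast P.hm
  let ρ : Euc m → ℝ := fun v => Real.exp (F (c + L v)) * (1 - ‖v‖ ^ 2) ^ m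
  have hρ : ContinuousOn ρ (Metric.closedBall 0 1) := by
    intro v hv
    have hv' : ‖v‖ ≤ 1 := by simpa using hv
    have h1 : ContinuousAt (fun v => F (c + L v)) v :=
      ContinuousAt.comp (f := fun v => c + L v) (g := F) (P.contF (hL v hv'))
        (by fun_prop)
    exact ((Real.continuous_exp.continuousAt.comp h1).mul (by fun_prop)).continuousWithinAt
  obtain ⟨v0, hv0, hmax⟩ := (isCompact_closedBall (0 : Euc m) 1).exists_isMaxOn
    ⟨0, by simp⟩ hρ
  have hv0' : ‖v0‖ ≤ 1 := by simpa using hv0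
  have hρ0 : ρ 0 = Real.exp (F c) := by simp [ρ]
  have h0 : Real.exp (F c) ≤ ρ v0 := by
    rw [← hρ0]; exact hmax (by simp)
  have hlt : ‖v0‖ < 1 := by
    rcases hv0'.eq_or_lt with h | h
    · have : ρ v0 = 0 := by simp [ρ, h, P.hm.ne']
      rw [this] at h0
      exact absurd h0 (not_le.mpr (Real.exp_pos _))
    · exact h
  set q : ℝ := 1 - ‖v0‖ ^ 2 with hq
  have hqpos : 0 < q := by nlinarith [norm_nonneg v0]
  set x0 := c + L v0 with hx0
  have hx0m : x0 ∈ Ω := hL v0 hv0'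
  have key : ∀ v, ⟪H x0 (L v), L v⟫ ≤ (4 * m / q ^ 2) * ‖v‖ ^ 2 := by
    intro v
    let Q : ℝ → ℝ := fun s => q - 2 * s * ⟪v0, v⟫ - s ^ 2 * ‖v‖ ^ 2
    let Q' : ℝ → ℝ := fun s => - 2 * ⟪v0, v⟫ - 2 * s * ‖v‖ ^ 2
    have hQeq : ∀ s, Q s = 1 - ‖v0 + s • v‖ ^ 2 := by
      intro s
      rw [norm_add_sq_real, inner_smul_right, norm_smul, mul_pow, Real.norm_eq_abs, sq_abs]
      simp only [Q, hq]; ring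
    have hQ0 : Q 0 = q := by simp [Q]
    have hQd : ∀ s, HasDerivAt Q (Q' s) s := by
      intro s
      have := ((((hasDerivAt_id s).const_mul 2).mul_const ⟪v0, v⟫).const_sub q).sub
        (((hasDerivAt_id s).pow 2).mul_const (‖v‖ ^ 2))
      refine this.congr_deriv ?_
      simp [Q']
    have hQ'd : HasDerivAt Q' (-2 * ‖v‖ ^ 2) 0 := by
      have := (((hasDerivAt_id (0:ℝ)).const_mul 2).mul_const (‖v‖ ^ 2)).const_sub (-2 * ⟪v0, v⟫)
      refine this.congr_deriv ?_
      simp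
    have hQpos : ∀ᶠ s in nhds (0:ℝ), 0 < Q s := by
      have : ContinuousAt Q 0 := (hQd 0).continuousAt
      exact this.eventually (lt_mem_nhds (by rw [hQ0]; exact hqpos))
    have hmem : ∀ s, 0 < Q s → x0 + s • L v ∈ Ω ∧ ‖v0 + s • v‖ ≤ 1 := by
      intro s hs
      rw [hQeq] at hs
      have h1 : ‖v0 + s • v‖ ≤ 1 := by
        by_contra h; push Not at h; nlinarith
      refine ⟨?_, h1⟩
      have := hL _ h1
      rw [map_add, map_smul, ← add_assoc] at this
      exact this
    have htest := second_test
      (φ := fun s => -(F (x0 + s • L v) + m * Real.log (Q s)))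
      (φ' := fun s => -(⟪G (x0 + s • L v), L v⟫ + m * (Q' s / Q s)))
      (c := -(⟪H (x0 + (0:ℝ) • L v) (L v), L v⟫ +
        m * (((-2 * ‖v‖ ^ 2) * Q 0 - Q' 0 * Q' 0) / Q 0 ^ 2))) ?_ ?_ ?_
    · rw [zero_smul, add_zero, hQ0] at htest
      have hQ'0 : Q' 0 = -2 * ⟪v0, v⟫ := by simp [Q']
      rw [hQ'0] at htest
      have hcs : ⟪v0, v⟫ ^ 2 ≤ ‖v0‖ ^ 2 * ‖v‖ ^ 2 := by
        rw [← mul_pow, ← sq_abs]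
        exact pow_le_pow_left₀ (abs_nonneg _) (abs_real_inner_le_norm v0 v) 2
      have h3 : ⟪H x0 (L v), L v⟫ ≤
          m * ((2 * ‖v‖ ^ 2 * q + 4 * ⟪v0, v⟫ ^ 2) / q ^ 2) := by
        have e : (-2 * ‖v‖ ^ 2 * q - -2 * ⟪v0, v⟫ * (-2 * ⟪v0, v⟫)) / q ^ 2 =
          -((2 * ‖v‖ ^ 2 * q + 4 * ⟪v0, v⟫ ^ 2) / q ^ 2) := by ring
        rw [e] at htest
        linarith
      refine h3.trans ?_
      have h4 : 2 * ‖v‖ ^ 2 * q + 4 * ⟪v0, v⟫ ^ 2 ≤ 4 * ‖v‖ ^ 2 := by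
        have : ‖v0‖ ^ 2 = 1 - q := by rw [hq]; ring
        rw [this] at hcs
        have hq1 : q ≤ 1 := by rw [hq]; nlinarith [sq_nonneg ‖v0‖]
        nlinarith [sq_nonneg ‖v‖]
      calc m * ((2 * ‖v‖ ^ 2 * q + 4 * ⟪v0, v⟫ ^ 2) / q ^ 2) ≤ m * ((4 * ‖v‖ ^ 2) / q ^ 2) := by
            gcongr
        _ = _ := by ring
    · filter_upwards [hQpos] with s hs
      exact ((P.line_deriv (hmem s hs).1).add (((hQd s).log hs.ne').const_mul (m:ℝ))).neg
    · have hs : 0 < Q 0 := by rw [hQ0]; exact hqpos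
      exact ((P.line_deriv2 (hmem 0 hs).1).add ((hQ'd.div (hQd 0) hs.ne').const_mul (m:ℝ))).neg
    · filter_upwards [hQpos] with s hs
      obtain ⟨h1, h2⟩ := hmem s hs
      have h3 : ρ (v0 + s • v) ≤ ρ v0 := hmax (by simpa using h2)
      have h4 : c + L (v0 + s • v) = x0 + s • L v := by
        rw [map_add, map_smul, ← add_assoc]
      simp only [ρ, h4, ← hQeq] at h3
      rw [← hx0, ← hq] at h3
      have e1 : Real.log (Real.exp (F (x0 + s • L v)) * Q s ^ m) =
          F (x0 + s • L v) + m * Real.log (Q s) := by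
        rw [Real.log_mul (Real.exp_pos _).ne' (pow_pos hs m).ne', Real.log_exp, Real.log_pow]
      have e2 : Real.log (Real.exp (F x0) * q ^ m) = F x0 + m * Real.log q := by
        rw [Real.log_mul (Real.exp_pos _).ne' (pow_pos hqpos m).ne', Real.log_exp, Real.log_pow]
      have h5 := Real.log_le_log (by positivity) h3
      rw [e1, e2] at h5
      simp only [zero_smul, add_zero, hQ0]
      linarith
  have hd := posSemi_of_le_smul (S := (H x0 : Euc m →ₗ[ℝ] Euc m)) (L := L)
    (fun v w => P.symm x0 hx0m v w) (fun v => P.nonneg hx0m v) key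
  rw [P.det x0 hx0m, div_pow, le_div_iff₀ (by positivity)] at hd
  have h6 : Real.exp (2 * F x0) = Real.exp (F x0) ^ 2 := by
    rw [← Real.exp_nat_mul]; norm_num
  rw [h6] at hd
  have hρv : ρ v0 = Real.exp (F x0) * q ^ m := rfl
  calc Real.exp (F c) ^ 2 * (LinearMap.det L) ^ 2
      ≤ ρ v0 ^ 2 * (LinearMap.det L) ^ 2 := by gcongr
    _ = Real.exp (F x0) ^ 2 * LinearMap.det L ^ 2 * (q ^ 2) ^ m := by rw [hρv]; ring
    _ ≤ _ := hd

theorem decay (P : Pot m Ω F G H) {x z : Euc m} (hx : x ∈ Ω) (hz : z ∈ closure Ω)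
    (hz0 : z ≠ 0) (C : ℝ) : ∃ s : ℝ, 0 ≤ s ∧ F (x + s • z) < C := by
  obtain ⟨r, hr, hrb⟩ := Metric.nhds_basis_closedBall.mem_iff.mp (P.isOpen.mem_nhds hx)
  have hzn : 0 < ‖z‖ := norm_pos_iff.mpr hz0
  have hm : (0:ℝ) < m := by exact_mod_cast P.hm
  set M : ℝ := (4 * m) ^ m / (Real.exp C ^ 2 * (r ^ m) ^ 2) with hM
  have hMpos : 0 < M := by positivity
  set k : ℝ := M / ‖z‖ ^ 2 with hk
  have hkpos : 0 < k := by positivity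
  refine ⟨r * k * ‖z‖, by positivity, ?_⟩
  by_contra hcon
  push Not at hcon
  let f : Module.Dual ℝ (Euc m) := k • (innerSL ℝ z : Euc m →L[ℝ] ℝ).toLinearMap
  have hf : ∀ v, f v = k * ⟪z, v⟫ := fun v => by simp [f]
  let L : Euc m →ₗ[ℝ] Euc m := r • LinearMap.transvection f z
  have hLv : ∀ v, L v = r • v + (r * (k * ⟪z, v⟫)) • z := by
    intro v
    simp [L, LinearMap.transvection.apply, hf, smul_smul]
  have hdet : LinearMap.det L = r ^ m * (1 + M) := by
    simp only [L, LinearMap.det_smul, LinearMap.transvection.det, hf]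
    rw [real_inner_self_eq_norm_sq, hk, div_mul_cancel₀ _ (by positivity)]
    simp
  have := P.interior_est (x + (r * k * ‖z‖) • z) L ?_
  · rw [hdet] at this
    have h1 : Real.exp C ^ 2 * (r ^ m * (1 + M)) ^ 2 ≤ (4 * m) ^ m := by
      refine le_trans ?_ this
      gcongr
    have h2 : Real.exp C ^ 2 * (r ^ m) ^ 2 * M = (4 * m) ^ m := by
      rw [hM]; field_simp
    have h3 : Real.exp C ^ 2 * (r ^ m) ^ 2 * M < Real.exp C ^ 2 * (r ^ m) ^ 2 * (1 + M) ^ 2 := by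
      gcongr
      nlinarith
    rw [h2] at h3
    rw [mul_pow, ← mul_assoc] at h1
    linarith
  · intro v hv
    have e : x + (r * k * ‖z‖) • z + L v = (x + r • v) + (r * k * (‖z‖ + ⟪z, v⟫)) • z := by
      rw [hLv]; module
    rw [e]
    refine P.add_mem (hrb ?_) hz ?_
    · rw [Metric.mem_closedBall, dist_eq_norm, add_sub_cancel_left, norm_smul, Real.norm_eq_abs,
        abs_of_pos hr]
      nlinarith
    · have := abs_le.mp (abs_real_inner_le_norm z v)
      have h2 : ‖z‖ * ‖v‖ ≤ ‖z‖ := by nlinarith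
      have : 0 ≤ ‖z‖ + ⟪z, v⟫ := by linarith [this.1]
      positivity

/-- `-∇F` maps `Ω` into the dual cone. -/
theorem neg_grad_mem (P : Pot m Ω F G H) {x : Euc m} (hx : x ∈ Ω) : -G x ∈ openDualCone Ω := by
  intro z hz hz0
  by_contra hcon
  push Not at hcon
  obtain ⟨s, hs, h⟩ := P.decay hx hz hz0 (F x)
  have h1 := P.tangent_le hx (P.add_mem hx hz hs)
  rw [add_sub_cancel_left, inner_smul_right] at h1
  rw [inner_neg_right, real_inner_comm] at hcon
  have : 0 ≤ s * ⟪G x, z⟫ := mul_nonneg hs (by linarith)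
  linarith

end Pot

/-! ### Dual cone -/

namespace Pot

variable {m : ℕ} {Ω : Set (Euc m)} {F : Euc m → ℝ} {G : Euc m → Euc m}
    {H : Euc m → Euc m →L[ℝ] Euc m}

theorem pair_bound (P : Pot m Ω F G H) {K : Set (Euc m)} (hK : IsCompact K)
    (hKd : ∀ y ∈ K, y ∈ openDualCone Ω) :
    ∃ δ : ℝ, 0 < δ ∧ ∀ x ∈ closure Ω, ∀ y ∈ K, δ * ‖x‖ ≤ ⟪x, y⟫ := by
  have hc : IsCompact ((closure Ω ∩ Metric.sphere (0 : Euc m) 1) ×ˢ K) :=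
    ((isCompact_sphere (0 : Euc m) 1).inter_left isClosed_closure).prod hK
  have hf : ContinuousOn (fun p : Euc m × Euc m => ⟪p.1, p.2⟫)
      ((closure Ω ∩ Metric.sphere (0 : Euc m) 1) ×ˢ K) := by fun_prop
  have main : ∃ δ : ℝ, 0 < δ ∧ ∀ x ∈ closure Ω, ‖x‖ = 1 → ∀ y ∈ K, δ ≤ ⟪x, y⟫ := by
    rcases ((closure Ω ∩ Metric.sphere (0 : Euc m) 1) ×ˢ K).eq_empty_or_nonempty with he | hne
    · refine ⟨1, one_pos, fun x hx hx1 y hy => ?_⟩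
      have : (x, y) ∈ ((closure Ω ∩ Metric.sphere (0 : Euc m) 1) ×ˢ K) :=
        ⟨⟨hx, by simpa using hx1⟩, hy⟩
      rw [he] at this
      exact this.elim
    · obtain ⟨p, hp, hmin⟩ := hc.exists_isMinOn hne hf
      refine ⟨⟪p.1, p.2⟫, hKd p.2 hp.2 p.1 hp.1.1 ?_, fun x hx hx1 y hy => ?_⟩
      · have := hp.1.2
        intro h
        rw [h] at this
        simp at this
      · exact hmin (a := (x, y)) ⟨⟨hx, by simpa using hx1⟩, hy⟩
  obtain ⟨δ, hδ, h⟩ := main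
  refine ⟨δ, hδ, fun x hx y hy => ?_⟩
  by_cases h0 : x = 0
  · simp [h0]
  have hn : 0 < ‖x‖ := norm_pos_iff.mpr h0
  have := h (‖x‖⁻¹ • x) (P.smul_mem_closure hx (inv_pos.mpr hn))
    (by rw [norm_smul, norm_inv, norm_norm, inv_mul_cancel₀ hn.ne']) y hy
  rw [inner_smul_left] at this
  simp only [conj_trivial] at this
  rw [inv_mul_eq_div, le_div_iff₀ hn] at this
  exact this

theorem isOpen_dual (P : Pot m Ω F G H) : IsOpen (openDualCone Ω) := by
  rw [Metric.isOpen_iff]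
  intro y hy
  obtain ⟨δ, hδ, h⟩ := P.pair_bound (K := {y}) isCompact_singleton (by simpa using hy)
  refine ⟨δ, hδ, fun y' hy' x hx hx0 => ?_⟩
  have h1 := h x hx y rfl
  have h2 : ‖y - y'‖ < δ := by
    rw [← dist_eq_norm, dist_comm]; exact hy'
  have h3 := real_inner_le_norm x (y - y')
  rw [inner_sub_right] at h3
  have hn : 0 < ‖x‖ := norm_pos_iff.mpr hx0
  nlinarith

theorem inner_pos (P : Pot m Ω F G H) {x y : Euc m} (hx : x ∈ Ω)
    (hy : y ∈ closure (openDualCone Ω)) (hy0 : y ≠ 0) : 0 < ⟪x, y⟫ := by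
  have hnn : ∀ z ∈ Ω, 0 ≤ ⟪z, y⟫ := by
    intro z hz
    have hcl : IsClosed {w : Euc m | 0 ≤ ⟪z, w⟫} :=
      isClosed_le continuous_const (by fun_prop)
    refine closure_minimal (fun w hw => ?_) hcl hy
    exact (hw z (subset_closure hz) (fun h => P.zero_notMem (h ▸ hz))).le
  have hc : Filter.Tendsto (fun t : ℝ => x - t • y) (nhdsWithin 0 (Set.Ioi 0)) (nhds x) := by
    have : Continuous (fun t : ℝ => x - t • y) := by fun_prop
    have := this.tendsto 0
    simp only [zero_smul, sub_zero] at this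
    exact this.mono_left nhdsWithin_le_nhds
  obtain ⟨t, ht, ht0⟩ := ((hc.eventually (P.isOpen.mem_nhds hx)).and
    self_mem_nhdsWithin).exists
  have h1 := hnn _ ht
  rw [inner_sub_left, inner_smul_left, real_inner_self_eq_norm_sq] at h1
  simp only [conj_trivial] at h1
  have hn : 0 < ‖y‖ := norm_pos_iff.mpr hy0
  have ht0' : 0 < t := ht0
  have : 0 < t * ‖y‖ ^ 2 := by positivity
  linarith

theorem lower_log (P : Pot m Ω F G H) : ∃ C : ℝ, ∀ x ∈ Ω, C - m * Real.log ‖x‖ ≤ F x := by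
  obtain ⟨C, hC⟩ := P.bddBelow 1
  refine ⟨C, fun x hx => ?_⟩
  have h0 : x ≠ 0 := fun h => P.zero_notMem (h ▸ hx)
  have hn : 0 < ‖x‖ := norm_pos_iff.mpr h0
  have h1 := hC _ (P.cone x hx _ (inv_pos.mpr hn))
    (by rw [norm_smul, norm_inv, norm_norm, inv_mul_cancel₀ hn.ne'])
  rw [P.hom x hx _ (inv_pos.mpr hn), Real.log_inv] at h1
  linarith

variable {Fd : Euc m → ℝ} {Gd : Euc m → Euc m} {Hd : Euc m → Euc m →L[ℝ] Euc m}
  {A : Euc m →L[ℝ] Euc m}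

theorem phi_hom (P : Pot m Ω F G H) (Pd : Pot m (openDualCone Ω) Fd Gd Hd) {x y : Euc m}
    (hx : x ∈ Ω) (hy : y ∈ openDualCone Ω) {t : ℝ} (ht : 0 < t) :
    F (t • x) + Fd (t⁻¹ • y) + ⟪t • x, A (t⁻¹ • y)⟫ = F x + Fd y + ⟪x, A y⟫ := by
  rw [P.hom x hx t ht, Pd.hom y hy _ (inv_pos.mpr ht), Real.log_inv, map_smul, inner_smul_left,
    inner_smul_right]
  simp only [conj_trivial]
  rw [← mul_assoc, mul_inv_cancel₀ ht.ne']
  ring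

theorem exists_min (P : Pot m Ω F G H) (Pd : Pot m (openDualCone Ω) Fd Gd Hd)
    (hA : ∀ y ∈ closure (openDualCone Ω), y ≠ 0 → A y ∈ openDualCone Ω)
    (hne : ∃ x y, x ∈ Ω ∧ y ∈ openDualCone Ω) :
    ∃ x0 ∈ Ω, ∃ y0 ∈ openDualCone Ω, ∀ x ∈ Ω, ∀ y ∈ openDualCone Ω,
      F x0 + Fd y0 + ⟪x0, A y0⟫ ≤ F x + Fd y + ⟪x, A y⟫ := by
  let Φ : Euc m × Euc m → ℝ := fun p => F p.1 + Fd p.2 + ⟪p.1, A p.2⟫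
  have hmpos : (0:ℝ) < m := by exact_mod_cast P.hm
  have hnorm : ∀ x ∈ Ω, ∀ y ∈ openDualCone Ω, ∃ x' ∈ Ω, ∃ y' ∈ openDualCone Ω, ‖y'‖ = 1 ∧
      Φ (x', y') = Φ (x, y) := by
    intro x hx y hy
    have hy0 : y ≠ 0 := fun h => Pd.zero_notMem (h ▸ hy)
    have hn : 0 < ‖y‖ := norm_pos_iff.mpr hy0
    refine ⟨‖y‖ • x, P.cone x hx _ hn, ‖y‖⁻¹ • y, Pd.cone y hy _ (inv_pos.mpr hn), ?_,
      P.phi_hom Pd hx hy hn⟩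
    rw [norm_smul, norm_inv, norm_norm, inv_mul_cancel₀ hn.ne']
  obtain ⟨a, b, ha, hb⟩ := hne
  obtain ⟨a', ha', b', hb', hb1, -⟩ := hnorm a ha b hb
  have hcont : ∀ p : Euc m × Euc m, p.1 ∈ Ω → p.2 ∈ openDualCone Ω → ContinuousAt Φ p := by
    intro p h1 h2
    have e1 : ContinuousAt (fun p : Euc m × Euc m => F p.1) p :=
      ContinuousAt.comp (P.contF h1) continuousAt_fst
    have e2 : ContinuousAt (fun p : Euc m × Euc m => Fd p.2) p :=
      ContinuousAt.comp (Pd.contF h2) continuousAt_snd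
    exact (e1.add e2).add (by fun_prop)
  set c := Φ (a', b') with hc
  let S : Set (Euc m × Euc m) :=
    {p | p.1 ∈ Ω ∧ p.2 ∈ openDualCone Ω ∧ ‖p.2‖ = 1 ∧ Φ p ≤ c}
  have hScomp : IsCompact S := by
    apply IsSeqCompact.isCompact
    intro p hp
    have hKc : IsCompact (closure (openDualCone Ω) ∩ Metric.sphere (0 : Euc m) 1) :=
      (isCompact_sphere (0 : Euc m) 1).inter_left isClosed_closure
    obtain ⟨δ, hδ, hδb⟩ := P.pair_bound (hKc.image A.continuous) (by
      rintro _ ⟨y, hy, rfl⟩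
      refine hA y hy.1 (fun h => ?_)
      have := hy.2
      rw [h] at this
      simp at this)
    obtain ⟨C, hC⟩ := P.lower_log
    obtain ⟨Cd, hCd⟩ := Pd.bddBelow 1
    have hpair : ∀ k, δ * ‖(p k).1‖ ≤ ⟪(p k).1, A (p k).2⟫ := fun k =>
      hδb _ (subset_closure (hp k).1) _
        ⟨(p k).2, ⟨subset_closure (hp k).2.1, by simpa using (hp k).2.2.1⟩, rfl⟩
    let α : ℝ := δ / (2 * m)
    have hα : 0 < α := by positivity
    have hbound : ∀ k, ‖(p k).1‖ ≤ (c - C - Cd - m * Real.log α) * 2 / δ := by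
      intro k
      have h0 : (p k).1 ≠ 0 := fun h => P.zero_notMem (h ▸ (hp k).1)
      have hn : 0 < ‖(p k).1‖ := norm_pos_iff.mpr h0
      have h1 := hC _ (hp k).1
      have h2 := hCd _ (hp k).2.1 (hp k).2.2.1.le
      have h3 : F (p k).1 + Fd (p k).2 + ⟪(p k).1, A (p k).2⟫ ≤ c := (hp k).2.2.2
      have h4 := Real.add_one_le_exp (Real.log (α * ‖(p k).1‖))
      rw [Real.exp_log (by positivity), Real.log_mul hα.ne' hn.ne'] at h4
      have h5 : m * (Real.log α + Real.log ‖(p k).1‖) ≤ m * (α * ‖(p k).1‖) := by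
        gcongr; linarith
      have h6 : m * (α * ‖(p k).1‖) = δ / 2 * ‖(p k).1‖ := by
        simp only [α]; field_simp
      rw [le_div_iff₀ hδ]
      linarith [hpair k]
    set R := (c - C - Cd - m * Real.log α) * 2 / δ
    have hball : ∀ k, p k ∈ Metric.closedBall (0 : Euc m) R ×ˢ Metric.closedBall (0 : Euc m) 1 :=
      fun k => ⟨by simpa using hbound k, by simpa using (hp k).2.2.1.le⟩
    obtain ⟨q, -, φ, hφ, hlim⟩ := ((isCompact_closedBall (0 : Euc m) R).prod
      (isCompact_closedBall (0 : Euc m) 1)).tendsto_subseq hball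
    have hlim1 : Filter.Tendsto (fun k => (p (φ k)).1) Filter.atTop (nhds q.1) :=
      (continuous_fst.tendsto q).comp hlim
    have hlim2 : Filter.Tendsto (fun k => (p (φ k)).2) Filter.atTop (nhds q.2) :=
      (continuous_snd.tendsto q).comp hlim
    obtain ⟨CR, hCR⟩ := P.bddBelow R
    have hq1 : q.1 ∈ Ω := by
      refine P.mem_of_tendsto (fun k => (hp (φ k)).1) hlim1 (C := c - Cd) (fun k => ?_)
      have h2 := hCd _ (hp (φ k)).2.1 (hp (φ k)).2.2.1.le
      have h3 : F (p (φ k)).1 + Fd (p (φ k)).2 + ⟪(p (φ k)).1, A (p (φ k)).2⟫ ≤ c :=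
        (hp (φ k)).2.2.2
      have h4 : 0 ≤ δ * ‖(p (φ k)).1‖ := by positivity
      linarith [hpair (φ k)]
    have hq2 : q.2 ∈ openDualCone Ω := by
      refine Pd.mem_of_tendsto (fun k => (hp (φ k)).2.1) hlim2 (C := c - CR) (fun k => ?_)
      have h2 := hCR _ (hp (φ k)).1 (hbound (φ k))
      have h3 : F (p (φ k)).1 + Fd (p (φ k)).2 + ⟪(p (φ k)).1, A (p (φ k)).2⟫ ≤ c :=
        (hp (φ k)).2.2.2
      have h4 : 0 ≤ δ * ‖(p (φ k)).1‖ := by positivity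
      linarith [hpair (φ k)]
    refine ⟨q, ⟨hq1, hq2, ?_, ?_⟩, φ, hφ, hlim⟩
    · refine tendsto_nhds_unique hlim2.norm ?_
      simp only [(hp (φ _)).2.2.1]
      exact tendsto_const_nhds
    · exact le_of_tendsto ((hcont q hq1 hq2).tendsto.comp hlim)
        (Filter.Eventually.of_forall fun k => (hp (φ k)).2.2.2)
  obtain ⟨p, hp, hmin⟩ := hScomp.exists_isMinOn (f := Φ) ⟨(a', b'), ha', hb', hb1, le_rfl⟩
    (fun p hp => (hcont p hp.1 hp.2.1).continuousWithinAt)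
  refine ⟨p.1, hp.1, p.2, hp.2.1, fun x hx y hy => ?_⟩
  obtain ⟨x', hx', y', hy', hy1, he⟩ := hnorm x hx y hy
  change Φ p ≤ Φ (x, y)
  rw [← he]
  by_cases h : Φ (x', y') ≤ c
  · exact hmin ⟨hx', hy', hy1, h⟩
  · exact (hp.2.2.2).trans (not_le.mp h).le

theorem lower_bound (P : Pot m Ω F G H) (Pd : Pot m (openDualCone Ω) Fd Gd Hd)
    (hA : ∀ y ∈ closure (openDualCone Ω), y ≠ 0 → A y ∈ openDualCone Ω)
    (hD : 0 < LinearMap.det (A : Euc m →ₗ[ℝ] Euc m))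
    {x y : Euc m} (hx : x ∈ Ω) (hy : y ∈ openDualCone Ω) :
    m + Real.log (LinearMap.det (A : Euc m →ₗ[ℝ] Euc m)) ≤ F x + Fd y + ⟪x, A y⟫ := by
  obtain ⟨x0, hx0, y0, hy0, hmin⟩ := P.exists_min Pd hA ⟨x, y, hx, hy⟩
  refine le_trans ?_ (hmin x hx y hy)
  have hmem : ∀ v w : Euc m, ∀ᶠ s in nhds (0:ℝ), x0 + s • v ∈ Ω ∧
      y0 + s • w ∈ openDualCone Ω := by
    intro v w
    have c1 : Continuous (fun s : ℝ => x0 + s • v) := by fun_prop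
    have c2 : Continuous (fun s : ℝ => y0 + s • w) := by fun_prop
    have t1 := c1.tendsto 0
    have t2 := c2.tendsto 0
    simp only [zero_smul, add_zero] at t1 t2
    exact (t1.eventually (P.isOpen.mem_nhds hx0)).and (t2.eventually (Pd.isOpen.mem_nhds hy0))
  have hlin1 : ∀ (a v : Euc m) (s : ℝ), HasDerivAt (fun s : ℝ => a + s • v) v s := by
    intro a v s
    have := ((hasDerivAt_id s).smul_const v).const_add a
    simp only [one_smul] at this
    exact this
  have hlinA : ∀ (a v : Euc m) (s : ℝ), HasDerivAt (fun s : ℝ => A (a + s • v)) (A v) s :=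
    fun a v s => A.hasFDerivAt.comp_hasDerivAt s (hlin1 a v s)
  have hφ : ∀ v w : Euc m, ∀ᶠ s in nhds (0:ℝ), HasDerivAt
      (fun s : ℝ => F (x0 + s • v) + Fd (y0 + s • w) + ⟪x0 + s • v, A (y0 + s • w)⟫)
      (⟪G (x0 + s • v), v⟫ + ⟪Gd (y0 + s • w), w⟫ +
        (⟪x0 + s • v, A w⟫ + ⟪v, A (y0 + s • w)⟫)) s := by
    intro v w
    filter_upwards [hmem v w] with s hs
    exact ((P.line_deriv hs.1).add (Pd.line_deriv hs.2)).add
      ((hlin1 x0 v s).inner ℝ (hlinA y0 w s))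
  have hloc : ∀ v w : Euc m, IsLocalMin
      (fun s : ℝ => F (x0 + s • v) + Fd (y0 + s • w) + ⟪x0 + s • v, A (y0 + s • w)⟫) 0 := by
    intro v w
    filter_upwards [hmem v w] with s hs
    simpa using hmin _ hs.1 _ hs.2
  have hfirst : ⟪x0, A y0⟫ = m := by
    have := (hloc x0 0).hasDerivAt_eq_zero (hφ x0 0).self_of_nhds
    simp only [zero_smul, add_zero, P.euler hx0, inner_zero_right, map_zero, zero_add] at this
    linarith
  have hsecond : ∀ v w, 0 ≤ ⟪H x0 v, v⟫ + ⟪Hd y0 w, w⟫ + 2 * ⟪v, A w⟫ := by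
    intro v w
    have h2 := second_test (hφ v w) (c := ⟪H x0 v, v⟫ + ⟪Hd y0 w, w⟫ +
      (⟪v, A w⟫ + ⟪v, A w⟫)) ?_ (hloc v w)
    · linarith
    · have hs := (hmem v w).self_of_nhds
      have e1 := P.line_deriv2 hs.1
      have e2 := Pd.line_deriv2 hs.2
      simp only [zero_smul, add_zero] at e1 e2
      have e3 := (hlin1 x0 v 0).inner ℝ (hasDerivAt_const (0:ℝ) (A w))
      have e4 := (hasDerivAt_const (0:ℝ) v).inner ℝ (hlinA y0 w 0)
      simp only [inner_zero_left, inner_zero_right, zero_add, add_zero] at e3 e4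
      exact (e1.add e2).add (e3.add e4)
  have hdet := det_joint (S := (H x0 : Euc m →ₗ[ℝ] Euc m)) (T := (Hd y0 : Euc m →ₗ[ℝ] Euc m))
    (A := (A : Euc m →ₗ[ℝ] Euc m))
    (fun v w => P.symm x0 hx0 v w) (fun v w => Pd.symm y0 hy0 v w) (fun v hv => P.pos x0 hx0 v hv)
    (by rw [P.det x0 hx0]; exact Real.exp_pos _) hsecond
  rw [P.det x0 hx0, Pd.det y0 hy0, ← Real.exp_add] at hdet
  have := Real.log_le_log (by positivity) hdet
  rw [Real.log_exp, Real.log_pow] at this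
  push_cast at this
  rw [hfirst]
  linarith

end Pot

/-! ### Upper bound -/

theorem hasDerivAt_inner_of_zero {m : ℕ} {h ξ : ℝ → Euc m} {ξ' : Euc m}
    (hh : ContinuousAt h 0) (hξ : HasDerivAt ξ ξ' 0) (h0 : ξ 0 = 0) :
    HasDerivAt (fun s => ⟪h s, ξ s⟫) ⟪h 0, ξ'⟫ 0 := by
  rw [hasDerivAt_iff_tendsto_slope] at hξ ⊢
  have : Filter.Tendsto (fun s => ⟪h s, slope ξ 0 s⟫) (nhdsWithin 0 {0}ᶜ) (nhds ⟪h 0, ξ'⟫) :=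
    (hh.tendsto.mono_left nhdsWithin_le_nhds).inner hξ
  refine this.congr (fun s => ?_)
  simp only [slope, vsub_eq_sub, h0, sub_zero, inner_zero_right, inner_smul_right, smul_eq_mul]

namespace Pot

variable {m : ℕ} {Ω : Set (Euc m)} {F : Euc m → ℝ} {G : Euc m → Euc m}
    {H : Euc m → Euc m →L[ℝ] Euc m}
    {Fd : Euc m → ℝ} {Gd : Euc m → Euc m} {Hd : Euc m → Euc m →L[ℝ] Euc m}
    {A : Euc m →L[ℝ] Euc m}

theorem grad_ne_zero (P : Pot m Ω F G H) {x : Euc m} (hx : x ∈ Ω) : G x ≠ 0 := by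
  intro h
  have := P.euler hx
  have hmpos : (0:ℝ) < m := by exact_mod_cast P.hm
  rw [h, inner_zero_left] at this
  linarith

theorem A_neg_grad_mem (P : Pot m Ω F G H)
    (hA : ∀ y ∈ closure (openDualCone Ω), y ≠ 0 → A y ∈ openDualCone Ω) {x : Euc m}
    (hx : x ∈ Ω) : A (-G x) ∈ openDualCone Ω :=
  hA _ (subset_closure (P.neg_grad_mem hx)) (neg_ne_zero.mpr (P.grad_ne_zero hx))

theorem exists_max (P : Pot m Ω F G H) (Pd : Pot m (openDualCone Ω) Fd Gd Hd)
    (hA : ∀ y ∈ closure (openDualCone Ω), y ≠ 0 → A y ∈ openDualCone Ω)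
    (hne : Ω.Nonempty) :
    ∃ x0 ∈ Ω, ∀ x ∈ Ω, F x + Fd (A (-G x)) ≤ F x0 + Fd (A (-G x0)) := by
  let u : Euc m → ℝ := fun x => F x + Fd (A (-G x))
  have hmpos : (0:ℝ) < m := by exact_mod_cast P.hm
  have hnorm : ∀ x ∈ Ω, ∃ x' ∈ Ω, ‖G x'‖ = 1 ∧ u x' = u x := by
    intro x hx
    have hn : 0 < ‖G x‖ := norm_pos_iff.mpr (P.grad_ne_zero hx)
    refine ⟨‖G x‖ • x, P.cone x hx _ hn, ?_, ?_⟩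
    · rw [P.grad_hom hx hn, norm_smul, norm_inv, norm_norm, inv_mul_cancel₀ hn.ne']
    · simp only [u]
      rw [P.grad_hom hx hn, ← smul_neg, map_smul, P.hom x hx _ hn,
        Pd.hom _ (P.A_neg_grad_mem hA hx) _ (inv_pos.mpr hn), Real.log_inv]
      ring
  obtain ⟨a, ha⟩ := hne
  obtain ⟨a', ha', ha1, -⟩ := hnorm a ha
  have hcont : ∀ x ∈ Ω, ContinuousAt u x := by
    intro x hx
    have e1 : ContinuousAt (fun x => A (-G x)) x :=
      A.continuous.continuousAt.comp (P.contG hx).neg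
    exact (P.contF hx).add (ContinuousAt.comp (g := Fd) (Pd.contF (P.A_neg_grad_mem hA hx)) e1)
  set c := u a' with hc
  let S : Set (Euc m) := {x | x ∈ Ω ∧ ‖G x‖ = 1 ∧ c ≤ u x}
  have hScomp : IsCompact S := by
    apply IsSeqCompact.isCompact
    intro p hp
    have hball : ∀ k, -G (p k) ∈ Metric.sphere (0 : Euc m) 1 := fun k => by
      simpa using (hp k).2.1
    obtain ⟨y, hy, φ, hφ, hlim⟩ := (isCompact_sphere (0 : Euc m) 1).tendsto_subseq hball
    have hycl : y ∈ closure (openDualCone Ω) := mem_closure_of_tendsto hlim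
      (Filter.Eventually.of_forall fun k => P.neg_grad_mem (hp (φ k)).1)
    have hy0 : y ≠ 0 := by
      intro h; rw [h] at hy; simp at hy
    have hlimA : Filter.Tendsto (fun k => Fd (A (-G (p (φ k))))) Filter.atTop
        (nhds (Fd (A y))) :=
      (Pd.contF (hA y hycl hy0)).tendsto.comp ((A.continuous.tendsto y).comp hlim)
    have hineq : ∀ z ∈ Ω, c - Fd (A y) + m ≤ F z + ⟪y, z⟫ := by
      intro z hz
      have hl : Filter.Tendsto (fun k => F z + ⟪-G (p (φ k)), z⟫ + Fd (A (-G (p (φ k)))))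
          Filter.atTop (nhds (F z + ⟪y, z⟫ + Fd (A y))) :=
        (tendsto_const_nhds.add (hlim.inner tendsto_const_nhds)).add hlimA
      have : c + m ≤ F z + ⟪y, z⟫ + Fd (A y) := by
        refine ge_of_tendsto hl (Filter.Eventually.of_forall fun k => ?_)
        have h1 := P.tangent_le (hp (φ k)).1 hz
        have h2 : c ≤ F (p (φ k)) + Fd (A (-G (p (φ k)))) := (hp (φ k)).2.2
        rw [inner_sub_right, P.euler (hp (φ k)).1] at h1
        rw [inner_neg_left]
        linarith
      linarith
    have hyd : y ∈ openDualCone Ω := by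
      intro z hz hz0
      by_contra hcon
      push Not at hcon
      obtain ⟨s, hs, h⟩ := P.decay ha hz hz0 (c - Fd (A y) + m - ⟪y, a⟫)
      have h1 := hineq _ (P.add_mem ha hz hs)
      rw [inner_add_right, inner_smul_right, real_inner_comm] at h1
      have h2 : s * ⟪z, y⟫ ≤ 0 := mul_nonpos_of_nonneg_of_nonpos hs hcon
      rw [real_inner_comm] at h2
      rw [real_inner_comm] at h
      first
        | linarith
        | (rw [real_inner_comm] at h2; linarith)
        | (rw [real_inner_comm] at h; linarith)
        | (rw [real_inner_comm] at h h2; linarith)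
    obtain ⟨δ, hδ, hδb⟩ := P.pair_bound hlim.isCompact_insert_range (by
      rintro w (rfl | ⟨k, rfl⟩)
      · exact hyd
      · exact P.neg_grad_mem (hp (φ k)).1)
    have hbound : ∀ k, p (φ k) ∈ Metric.closedBall (0 : Euc m) (m / δ) := by
      intro k
      have h1 := hδb _ (subset_closure (hp (φ k)).1) (-G (p (φ k)))
        (Set.mem_insert_of_mem _ ⟨k, rfl⟩)
      rw [inner_neg_right, real_inner_comm, P.euler (hp (φ k)).1, neg_neg] at h1
      rw [mem_closedBall_zero_iff, le_div_iff₀ hδ]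
      linarith
    obtain ⟨q, -, ψ, hψ, hlim'⟩ :=
      (isCompact_closedBall (0 : Euc m) (m / δ)).tendsto_subseq hbound
    have hqm : q ∈ Ω := by
      refine P.mem_of_tendsto (fun k => (hp (φ (ψ k))).1) hlim' (C := F a + ‖a‖ - m)
        (fun k => ?_)
      have h1 := P.tangent_le (hp (φ (ψ k))).1 ha
      rw [inner_sub_right, P.euler (hp (φ (ψ k))).1] at h1
      have h2 := (abs_le.mp (abs_real_inner_le_norm (G (p (φ (ψ k)))) a)).1
      rw [(hp (φ (ψ k))).2.1] at h2
      linarith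
    refine ⟨q, ⟨hqm, ?_, ?_⟩, φ ∘ ψ, hφ.comp hψ, hlim'⟩
    · have h1 : Filter.Tendsto (fun k => ‖G (p (φ (ψ k)))‖) Filter.atTop (nhds ‖G q‖) :=
        ((P.contG hqm).tendsto.comp hlim').norm
      refine tendsto_nhds_unique h1 ?_
      simp only [(hp (φ (ψ _))).2.1]
      exact tendsto_const_nhds
    · exact ge_of_tendsto ((hcont q hqm).tendsto.comp hlim')
        (Filter.Eventually.of_forall fun k => (hp (φ (ψ k))).2.2)
  obtain ⟨p, hp, hmax⟩ := hScomp.exists_isMaxOn (f := u) ⟨a', ha', ha1, le_rfl⟩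
    (fun p hp => (hcont p hp.1).continuousWithinAt)
  refine ⟨p, hp.1, fun x hx => ?_⟩
  obtain ⟨x', hx', hx1, he⟩ := hnorm x hx
  change u x ≤ u p
  rw [← he]
  by_cases h : c ≤ u x'
  · exact hmax ⟨hx', hx1, h⟩
  · exact (not_le.mp h).le.trans hp.2.2

theorem upper_bound (P : Pot m Ω F G H) (Pd : Pot m (openDualCone Ω) Fd Gd Hd)
    (hA : ∀ y ∈ closure (openDualCone Ω), y ≠ 0 → A y ∈ openDualCone Ω)
    (hD : 0 < LinearMap.det (A : Euc m →ₗ[ℝ] Euc m))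
    {x : Euc m} (hx : x ∈ Ω) :
    F x + Fd (A (-G x)) ≤ - Real.log (LinearMap.det (A : Euc m →ₗ[ℝ] Euc m)) := by
  obtain ⟨x0, hx0, hmax⟩ := P.exists_max Pd hA ⟨x, hx⟩
  refine (hmax x hx).trans ?_
  set y0 := A (-G x0) with hy0
  have hy0m : y0 ∈ openDualCone Ω := P.A_neg_grad_mem hA hx0
  let B := ContinuousLinearMap.adjoint A
  have hB : ∀ v w, ⟪v, B w⟫ = ⟪A v, w⟫ := fun v w => ContinuousLinearMap.adjoint_inner_right A v w
  have hmem : ∀ v : Euc m, ∀ᶠ s in nhds (0:ℝ), x0 + s • v ∈ Ω := by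
    intro v
    have c1 : Continuous (fun s : ℝ => x0 + s • v) := by fun_prop
    have t1 := c1.tendsto 0
    simp only [zero_smul, add_zero] at t1
    exact t1.eventually (P.isOpen.mem_nhds hx0)
  have hlin1 : ∀ (a v : Euc m) (s : ℝ), HasDerivAt (fun s : ℝ => a + s • v) v s := by
    intro a v s
    have := ((hasDerivAt_id s).smul_const v).const_add a
    simp only [one_smul] at this
    exact this
  have hY : ∀ (v : Euc m) (s : ℝ), x0 + s • v ∈ Ω →
      HasDerivAt (fun s : ℝ => A (-G (x0 + s • v))) (A (-(H (x0 + s • v) v))) s :=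
    fun v s hs => A.hasFDerivAt.comp_hasDerivAt s (P.line_derivG hs).neg
  let ξ : Euc m → ℝ → Euc m := fun v s => x0 + s • v + B (Gd (A (-G (x0 + s • v))))
  have hφ : ∀ v : Euc m, ∀ᶠ s in nhds (0:ℝ), HasDerivAt
      (fun s : ℝ => -(F (x0 + s • v) + Fd (A (-G (x0 + s • v)))))
      ⟪H (x0 + s • v) v, ξ v s⟫ s := by
    intro v
    filter_upwards [hmem v] with s hs
    have h1 : HasDerivAt (fun s : ℝ => Fd (A (-G (x0 + s • v))))
        (⟪Gd (A (-G (x0 + s • v))), A (-(H (x0 + s • v) v))⟫) s := by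
      have := HasFDerivAt.comp_hasDerivAt_of_eq s (Pd.grad _ (P.A_neg_grad_mem hA hs)) (hY v s hs)
        rfl
      simp only [innerSL_apply_apply] at this
      exact this
    refine ((P.line_deriv hs).add h1).neg.congr_deriv ?_
    simp only [ξ]
    generalize Gd (A (-G (x0 + s • v))) = g
    rw [inner_add_right, hB, P.symm _ hs, P.euler2 hs, map_neg, inner_neg_right, inner_neg_right]
    have e1 := real_inner_comm v (G (x0 + s • v))
    have e2 := real_inner_comm g (A (H (x0 + s • v) v))
    linarith
  have hloc : ∀ v : Euc m, IsLocalMin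
      (fun s : ℝ => -(F (x0 + s • v) + Fd (A (-G (x0 + s • v))))) 0 := by
    intro v
    filter_upwards [hmem v] with s hs
    have := hmax _ hs
    simp only [zero_smul, add_zero]
    rw [← hy0]
    linarith
  have hξ0 : ∀ v, ξ v 0 = x0 + B (Gd y0) := by
    intro v; simp [ξ, hy0]
  have hzero : x0 + B (Gd y0) = 0 := by
    by_contra hne
    have h1 := (hloc (x0 + B (Gd y0))).hasDerivAt_eq_zero (hφ (x0 + B (Gd y0))).self_of_nhds
    rw [hξ0, zero_smul, add_zero] at h1
    exact absurd h1 (P.pos x0 hx0 _ hne).ne'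
  have hsecond : ∀ v, ⟪Hd y0 (A (H x0 v)), A (H x0 v)⟫ ≤ ⟪H x0 v, v⟫ := by
    intro v
    have hs := (hmem v).self_of_nhds
    have hξd : HasDerivAt (ξ v) (v + B (Hd y0 (A (-(H x0 v))))) 0 := by
      have e1 := hY v 0 hs
      have e2 : HasDerivAt (fun s : ℝ => Gd (A (-G (x0 + s • v)))) (Hd y0 (A (-(H x0 v)))) 0 := by
        have := HasFDerivAt.comp_hasDerivAt_of_eq (0:ℝ) (Pd.hess _ (P.A_neg_grad_mem hA hs)) e1 rfl
        simp only [zero_smul, add_zero] at this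
        exact this
      exact (hlin1 x0 v 0).add (B.hasFDerivAt.comp_hasDerivAt (0:ℝ) e2)
    have hcH : ContinuousAt (fun s : ℝ => H (x0 + s • v) v) 0 := by
      have h1 : ContinuousAt H (x0 + (0:ℝ) • v) := P.contH.continuousAt (P.isOpen.mem_nhds hs)
      have h2 : ContinuousAt (fun s : ℝ => H (x0 + s • v)) 0 :=
        ContinuousAt.comp (f := fun s : ℝ => x0 + s • v) h1 (by fun_prop)
      exact h2.clm_apply continuousAt_const
    have h3 := hasDerivAt_inner_of_zero hcH hξd (by rw [hξ0, hzero])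
    have h4 := second_test (hφ v) h3 (hloc v)
    simp only [zero_smul, add_zero] at h4
    rw [inner_add_right, hB, map_neg, map_neg, inner_neg_right, real_inner_comm] at h4
    have h5 := real_inner_comm (H x0 v) v
    have h6 := real_inner_comm (Hd y0 (A (H x0 v))) (A (H x0 v))
    linarith
  have hdet := det_mono_comp (S := (Hd y0 : Euc m →ₗ[ℝ] Euc m))
    (T := (H x0 : Euc m →ₗ[ℝ] Euc m))
    (L := (A : Euc m →ₗ[ℝ] Euc m) ∘ₗ (H x0 : Euc m →ₗ[ℝ] Euc m))
    (fun v w => Pd.symm y0 hy0m v w) (fun v w => P.symm x0 hx0 v w)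
    (fun v => Pd.nonneg hy0m v) hsecond
  rw [LinearMap.det_comp, P.det x0 hx0, Pd.det y0 hy0m] at hdet
  have := Real.log_le_log (by positivity) hdet
  rw [Real.log_mul (by positivity) (by positivity), Real.log_pow,
    Real.log_mul (by positivity) (by positivity), Real.log_exp, Real.log_exp] at this
  push_cast at this
  linarith

end Pot

/-! ### Limits and the dual gradient -/

theorem convex_dual {m : ℕ} (Ω : Set (Euc m)) : Convex ℝ (openDualCone Ω) := by
  intro y hy z hz a b ha hb hab x hx hx0
  rw [inner_add_right, inner_smul_right, inner_smul_right]
  have h1 := hy x hx hx0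
  have h2 := hz x hx hx0
  rcases ha.eq_or_lt with rfl | ha
  · have : b = 1 := by linarith
    subst this
    linarith
  · have := mul_pos ha h1
    have := mul_nonneg hb h2.le
    linarith

theorem cone_dual {m : ℕ} (Ω : Set (Euc m)) (y : Euc m) (hy : y ∈ openDualCone Ω) (t : ℝ)
    (ht : 0 < t) : t • y ∈ openDualCone Ω := by
  intro x hx hx0
  rw [inner_smul_right]
  exact mul_pos ht (hy x hx hx0)

namespace Pot

variable {m : ℕ} {Ω : Set (Euc m)} {F : Euc m → ℝ} {G : Euc m → Euc m}
    {H : Euc m → Euc m →L[ℝ] Euc m}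
    {Fd : Euc m → ℝ} {Gd : Euc m → Euc m} {Hd : Euc m → Euc m →L[ℝ] Euc m}

/-- A rank one perturbation of the identity. -/
def pert (x1 y1 : Euc m) (t : ℝ) : Euc m →L[ℝ] Euc m :=
  ContinuousLinearMap.id ℝ (Euc m) + (t • innerSL ℝ x1).smulRight y1

theorem pert_apply (x1 y1 : Euc m) (t : ℝ) (y : Euc m) :
    pert x1 y1 t y = y + (t * ⟪x1, y⟫) • y1 := by
  simp [pert]

theorem pert_det (x1 y1 : Euc m) (t : ℝ) :
    LinearMap.det (pert x1 y1 t : Euc m →ₗ[ℝ] Euc m) = 1 + t * ⟪x1, y1⟫ := by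
  have : (pert x1 y1 t : Euc m →ₗ[ℝ] Euc m)
      = LinearMap.transvection ((t • innerSL ℝ x1 : Euc m →L[ℝ] ℝ) : Euc m →ₗ[ℝ] ℝ) y1 := by
    ext y : 1
    simp [pert, LinearMap.transvection.apply]
  rw [this, LinearMap.transvection.det]
  simp

theorem pert_mem (P : Pot m Ω F G H) {x1 y1 : Euc m} (hx1 : x1 ∈ Ω) (hy1 : y1 ∈ openDualCone Ω)
    {t : ℝ} (ht : 0 < t) :
    ∀ y ∈ closure (openDualCone Ω), y ≠ 0 → pert x1 y1 t y ∈ openDualCone Ω := by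
  intro y hy hy0 z hz hz0
  have h1 : 0 ≤ ⟪z, y⟫ := by
    have hcl : IsClosed {w : Euc m | 0 ≤ ⟪z, w⟫} := isClosed_le continuous_const (by fun_prop)
    exact closure_minimal (fun w hw => (hw z hz hz0).le) hcl hy
  have h2 := P.inner_pos hx1 hy hy0
  have h3 := hy1 z hz hz0
  rw [pert_apply, inner_add_right, inner_smul_right]
  positivity

theorem pert_tendsto (x1 y1 y : Euc m) :
    Filter.Tendsto (fun t => pert x1 y1 t y) (nhdsWithin 0 (Set.Ioi 0)) (nhds y) := by
  have : Continuous (fun t => pert x1 y1 t y) := by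
    simp only [pert_apply]
    fun_prop
  have h := this.tendsto 0
  rw [pert_apply, zero_mul, zero_smul, add_zero] at h
  exact h.mono_left nhdsWithin_le_nhds

theorem logdet_tendsto (x1 y1 : Euc m) :
    Filter.Tendsto (fun t => Real.log (1 + t * ⟪x1, y1⟫)) (nhdsWithin (0:ℝ) (Set.Ioi 0))
      (nhds 0) := by
  have h1 : ContinuousAt (fun t : ℝ => Real.log (1 + t * ⟪x1, y1⟫)) 0 := by
    apply ContinuousAt.log
    · fun_prop
    · simp
  have h := h1.tendsto
  rw [zero_mul, add_zero, Real.log_one] at h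
  exact h.mono_left nhdsWithin_le_nhds

theorem sharp_lower (P : Pot m Ω F G H) (Pd : Pot m (openDualCone Ω) Fd Gd Hd)
    {x y : Euc m} (hx : x ∈ Ω) (hy : y ∈ openDualCone Ω) : m ≤ F x + Fd y + ⟪x, y⟫ := by
  have hpos : 0 < ⟪x, y⟫ := P.inner_pos hx (subset_closure hy) fun h => Pd.zero_notMem (h ▸ hy)
  have t1 : Filter.Tendsto (fun t => (m:ℝ) + Real.log (1 + t * ⟪x, y⟫))
      (nhdsWithin (0:ℝ) (Set.Ioi 0)) (nhds (m + 0)) := tendsto_const_nhds.add (logdet_tendsto x y)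
  have t2 : Filter.Tendsto (fun t => F x + Fd y + ⟪x, pert x y t y⟫)
      (nhdsWithin (0:ℝ) (Set.Ioi 0)) (nhds (F x + Fd y + ⟪x, y⟫)) :=
    tendsto_const_nhds.add (tendsto_const_nhds.inner (pert_tendsto x y y))
  rw [add_zero] at t1
  refine le_of_tendsto_of_tendsto t1 t2 ?_
  filter_upwards [self_mem_nhdsWithin] with t ht
  have ht' : 0 < t := ht
  have := P.lower_bound Pd (P.pert_mem hx hy ht') (by rw [pert_det]; positivity) hx hy
  rwa [pert_det] at this

theorem sharp_upper (P : Pot m Ω F G H) (Pd : Pot m (openDualCone Ω) Fd Gd Hd)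
    {x : Euc m} (hx : x ∈ Ω) : F x + Fd (-G x) ≤ 0 := by
  have hy := P.neg_grad_mem hx
  have hpos : 0 < ⟪x, -G x⟫ :=
    P.inner_pos hx (subset_closure hy) fun h => Pd.zero_notMem (h ▸ hy)
  have t1 := (logdet_tendsto x (-G x)).neg
  have t2 : Filter.Tendsto (fun t => F x + Fd (pert x (-G x) t (-G x)))
      (nhdsWithin (0:ℝ) (Set.Ioi 0)) (nhds (F x + Fd (-G x))) :=
    tendsto_const_nhds.add ((Pd.contF hy).tendsto.comp (pert_tendsto x (-G x) (-G x)))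
  rw [neg_zero] at t1
  refine le_of_tendsto_of_tendsto t2 t1 ?_
  filter_upwards [self_mem_nhdsWithin] with t ht
  have ht' : 0 < t := ht
  have := P.upper_bound Pd (P.pert_mem hx hy ht') (by rw [pert_det]; positivity) hx
  rwa [pert_det] at this

theorem dual_grad (P : Pot m Ω F G H) (Pd : Pot m (openDualCone Ω) Fd Gd Hd)
    {x : Euc m} (hx : x ∈ Ω) : Gd (-G x) = -x := by
  have hy := P.neg_grad_mem hx
  have hmin : IsLocalMin (fun y => Fd y + ⟪x, y⟫) (-G x) := by
    filter_upwards [Pd.isOpen.mem_nhds hy] with y hy'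
    have h1 := P.sharp_lower Pd hx hy'
    have h2 := P.sharp_upper Pd hx
    have h3 := P.euler hx
    have h4 := real_inner_comm x (G x)
    rw [inner_neg_right]
    linarith
  have hd : HasFDerivAt (fun y => Fd y + ⟪x, y⟫) (innerSL ℝ (Gd (-G x)) + innerSL ℝ x) (-G x) :=
    (Pd.grad _ hy).add (innerSL ℝ x).hasFDerivAt
  have h0 := hmin.hasFDerivAt_eq_zero hd
  rw [eq_neg_iff_add_eq_zero]
  refine ext_inner_right ℝ fun v => ?_
  have := congrArg (fun f => f v) h0
  simpa [inner_add_left] using this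

theorem dual_hess (P : Pot m Ω F G H) (Pd : Pot m (openDualCone Ω) Fd Gd Hd)
    {x : Euc m} (hx : x ∈ Ω) : (Hd (-G x)).comp (H x) = ContinuousLinearMap.id ℝ (Euc m) := by
  have h1 : HasFDerivAt (fun z => Gd (-G z)) ((Hd (-G x)).comp (-H x)) x :=
    HasFDerivAt.comp x (g := Gd) (f := fun z => -G z) (Pd.hess _ (P.neg_grad_mem hx))
      (P.hess x hx).neg
  have h2 : HasFDerivAt (fun z => Gd (-G z)) (-ContinuousLinearMap.id ℝ (Euc m)) x := by
    refine (hasFDerivAt_id x).neg.congr_of_eventuallyEq ?_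
    filter_upwards [P.isOpen.mem_nhds hx] with z hz
    exact P.dual_grad Pd hz
  have h3 := h1.unique h2
  rw [ContinuousLinearMap.comp_neg] at h3
  exact neg_injective h3

end Pot

/-! ### Conversion to matrices -/

theorem hessMatrix_apply {m : ℕ} {F : Euc m → ℝ} {x : Euc m} (i j : Fin m) :
    hessMatrix F x i j = fderiv ℝ (fderiv ℝ F) x (EuclideanSpace.single i 1)
      (EuclideanSpace.single j 1) := by
  simp [hessMatrix, iteratedFDeriv_two_apply]

theorem gradient_facts {m : ℕ} {Ω : Set (Euc m)} (hO : IsOpen Ω) {F : Euc m → ℝ}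
    (hF : ContDiffOn ℝ (⊤ : ℕ∞) F Ω) {x : Euc m} (hx : x ∈ Ω) :
    HasFDerivAt F (innerSL ℝ (gradient F x)) x ∧
    HasFDerivAt (gradient F) (fderiv ℝ (gradient F) x) x ∧
    ContinuousAt (fderiv ℝ (gradient F)) x ∧
    (∀ v w, ⟪fderiv ℝ (gradient F) x v, w⟫ = fderiv ℝ (fderiv ℝ F) x v w) ∧
    (∀ v w, ⟪fderiv ℝ (gradient F) x v, w⟫ = ⟪v, fderiv ℝ (gradient F) x w⟫) := by
  have hc : ContDiffAt ℝ (⊤ : ℕ∞) F x := hF.contDiffAt (hO.mem_nhds hx)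
  have hc2 : ContDiffAt ℝ 2 F x := hc.of_le (WithTop.coe_le_coe.mpr (le_top (a := (2 : ℕ∞))))
  have hc3 : ContDiffAt ℝ 2 (fderiv ℝ F) x := hc.fderiv_right (WithTop.coe_le_coe.mpr (le_top (a := (3 : ℕ∞))))
  have hcg : ContDiffAt ℝ 2 (gradient F) x := by
    have := (InnerProductSpace.toDual ℝ (Euc m)).symm.contDiff.contDiffAt.comp x hc3
      (n := 2)
    exact this
  have hdg : DifferentiableAt ℝ (gradient F) x := hcg.differentiableAt (by norm_num)
  have hin : ∀ v w, ⟪fderiv ℝ (gradient F) x v, w⟫ = fderiv ℝ (fderiv ℝ F) x v w := by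
    intro v w
    have e1 : HasFDerivAt (fun z => ⟪gradient F z, w⟫)
        ((innerSL ℝ w).comp (fderiv ℝ (gradient F) x)) x := by
      have := (innerSL ℝ w).hasFDerivAt.comp x hdg.hasFDerivAt
      refine this.congr_of_eventuallyEq (Filter.Eventually.of_forall fun z => ?_)
      simp
    have e2 : HasFDerivAt (fun z => ⟪gradient F z, w⟫)
        ((ContinuousLinearMap.apply ℝ ℝ w).comp (fderiv ℝ (fderiv ℝ F) x)) x := by
      have := (ContinuousLinearMap.apply ℝ ℝ w).hasFDerivAt.comp x
        (hc3.differentiableAt (by norm_num)).hasFDerivAt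
      refine this.congr_of_eventuallyEq (Filter.Eventually.of_forall fun z => ?_)
      simp [gradient]
    have := congrArg (fun f => f v) (e1.unique e2)
    simp only [ContinuousLinearMap.comp_apply, innerSL_apply_apply,
      ContinuousLinearMap.apply_apply] at this
    rw [real_inner_comm]
    exact this
  refine ⟨?_, hdg.hasFDerivAt, ?_, hin, fun v w => ?_⟩
  · have := (hc2.differentiableAt (by norm_num)).hasGradientAt.hasFDerivAt
    exact this
  · exact (hcg.fderiv_right (m := 1) (by norm_num)).continuousAt
  · rw [real_inner_comm _ v, hin, hin]
    exact hc2.isSymmSndFDerivAt (by simp) v w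

theorem toMatrix_hess {m : ℕ} {Ω : Set (Euc m)} (hO : IsOpen Ω) {F : Euc m → ℝ}
    (hF : ContDiffOn ℝ (⊤ : ℕ∞) F Ω) {x : Euc m} (hx : x ∈ Ω) :
    LinearMap.toMatrix (EuclideanSpace.basisFun (Fin m) ℝ).toBasis
      (EuclideanSpace.basisFun (Fin m) ℝ).toBasis
      (fderiv ℝ (gradient F) x : Euc m →ₗ[ℝ] Euc m) = hessMatrix F x := by
  obtain ⟨-, -, -, hin, hsymm⟩ := gradient_facts hO hF hx
  ext i j
  rw [LinearMap.toMatrix_apply, hessMatrix_apply, ← hin, hsymm]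
  simp [EuclideanSpace.inner_single_left]

theorem pot_of_canonical {n : ℕ} {Ω : Set (Euc (n + 1))} (hO : IsOpen Ω) (hC : Convex ℝ Ω)
    (hcone : ∀ x ∈ Ω, ∀ t : ℝ, 0 < t → t • x ∈ Ω) {F : Euc (n + 1) → ℝ}
    (hF : IsCanonicalPotential n Ω F) :
    Pot (n + 1) Ω F (gradient F) (fun x => fderiv ℝ (gradient F) x) := by
  obtain ⟨hsm, hpd, hdet, hhom, hbl⟩ := hF
  refine ⟨n.succ_pos, hO, hC, hcone, fun x hx => (gradient_facts hO hsm hx).1,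
    fun x hx => (gradient_facts hO hsm hx).2.1,
    fun x hx => (gradient_facts hO hsm hx).2.2.1.continuousWithinAt,
    fun x hx => (gradient_facts hO hsm hx).2.2.2.2, ?_, ?_, ?_, hbl⟩
  · intro x hx v hv
    have h1 := (hpd x hx).dotProduct_mulVec_pos (x := v.ofLp) (by
      intro h; exact hv (by ext i; exact congrFun h i))
    rw [← toMatrix_hess hO hsm hx] at h1
    rw [real_inner_comm]
    have h2 : ∀ L : Euc (n+1) →ₗ[ℝ] Euc (n+1), (LinearMap.toMatrix
        (EuclideanSpace.basisFun (Fin (n+1)) ℝ).toBasis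
        (EuclideanSpace.basisFun (Fin (n+1)) ℝ).toBasis L).mulVec v.ofLp = (L v).ofLp := by
      intro L
      have := LinearMap.toMatrix_mulVec_repr (EuclideanSpace.basisFun (Fin (n+1)) ℝ).toBasis
        (EuclideanSpace.basisFun (Fin (n+1)) ℝ).toBasis L v
      have e : ∀ w : Euc (n+1),
          ⇑((EuclideanSpace.basisFun (Fin (n+1)) ℝ).toBasis.repr w) = w.ofLp := by
        intro w; ext i; simp
      rw [e, e] at this
      exact this
    rw [h2] at h1
    rw [EuclideanSpace.inner_eq_star_dotProduct, dotProduct_comm]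
    exact h1
  · intro x hx
    rw [← hdet x hx, ← toMatrix_hess hO hsm hx, LinearMap.det_toMatrix]
  · intro x hx t ht
    have := hhom x hx (Real.log t)
    rw [Real.exp_log ht] at this
    rw [this]
    push_cast
    ring

/-- The Hessian of the canonical potential of the dual cone at `-∇F_Ω(x)` is the inverse
of the Hessian of the canonical potential of `Ω` at `x`; hence `x ↦ -∇F_Ω(x)` is an
isometry of the corresponding Hessian metrics. -/
theorem canonical_potential_dual_hessian_inverse
    (n : ℕ) (Ω : Set (Euc (n + 1))) (hΩ : IsOpenProperConvexCone Ω)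
    (F : Euc (n + 1) → ℝ) (hF : IsCanonicalPotential n Ω F)
    (Fd : Euc (n + 1) → ℝ) (hFd : IsCanonicalPotential n (openDualCone Ω) Fd) :
    ∀ x ∈ Ω, hessMatrix Fd (-gradient F x) = (hessMatrix F x)⁻¹ := by
  intro x hx
  obtain ⟨-, hO, hC, hcone, -⟩ := hΩ
  have hcone' : ∀ x ∈ Ω, ∀ t : ℝ, 0 < t → t • x ∈ Ω := by
    intro x hx t ht
    have := hcone x hx (Real.log t)
    rwa [Real.exp_log ht] at this
  have P := pot_of_canonical hO hC hcone' hF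
  have Pd := pot_of_canonical P.isOpen_dual (convex_dual Ω) (cone_dual Ω) hFd
  have h := P.dual_hess Pd hx
  symm
  apply Matrix.inv_eq_left_inv
  rw [← toMatrix_hess hO hF.1 hx, ← toMatrix_hess P.isOpen_dual hFd.1 (P.neg_grad_mem hx),
    ← LinearMap.toMatrix_comp, ← ContinuousLinearMap.toLinearMap_comp, h]
  exact LinearMap.toMatrix_id _
end
end

section
/- Let Ω ⊆ ℝ^{n+1} be a nonempty proper open convex cone with open dual cone Ω*, let F be a canonical potential of Ω, and define u : Ω → ℝ by u(x) = −((n+1)/2)·e^{−2F(x)/(n+1)}. Then the map x ↦ −∇u(x) sends Ω into Ω* and is a bijection from Ω onto Ω*, with invertible derivative −D²u(x) at every x ∈ Ω. -/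
open scoped RealInnerProductSpace

noncomputable section

theorem euc_sum {m : ℕ} (v : Euc m) :
    ∑ i, v i • (EuclideanSpace.single i (1 : ℝ) : Euc m) = v := by
  have := (EuclideanSpace.basisFun (Fin m) ℝ).sum_repr v
  simpa using this

theorem hess_apply {m : ℕ} (F : Euc m → ℝ) (x : Euc m) (i j : Fin m) :
    hessMatrix F x i j = fderiv ℝ (fderiv ℝ F) x (EuclideanSpace.single i 1)
      (EuclideanSpace.single j 1) := by
  simp [hessMatrix, iteratedFDeriv_two_apply]

theorem hess_vecMul {m : ℕ} (F : Euc m → ℝ) (x v : Euc m) (j : Fin m) :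
    Matrix.vecMul v (hessMatrix F x) j = fderiv ℝ (fderiv ℝ F) x v
      (EuclideanSpace.single j 1) := by
  conv_rhs => rw [← euc_sum v]
  simp [Matrix.vecMul, dotProduct, hess_apply]

theorem hess_quad {m : ℕ} (F : Euc m → ℝ) (x v w : Euc m) :
    Matrix.vecMul v (hessMatrix F x) ⬝ᵥ w = fderiv ℝ (fderiv ℝ F) x v w := by
  conv_rhs => rw [← euc_sum w]
  simp only [dotProduct, hess_vecMul, map_sum, map_smul, smul_eq_mul]
  exact Finset.sum_congr rfl fun i _ => mul_comm _ _

theorem hess_pos {m : ℕ} {F : Euc m → ℝ} {x : Euc m} (h : (hessMatrix F x).PosDef)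
    {v : Euc m} (hv : v ≠ 0) : 0 < fderiv ℝ (fderiv ℝ F) x v v := by
  have h1 : (v : Fin m → ℝ) ≠ 0 := by
    intro h0
    apply hv
    ext i
    exact congrFun h0 i
  have := h.dotProduct_mulVec_pos h1
  rw [← hess_quad, ← Matrix.dotProduct_mulVec]
  simpa using this

section
variable {n : ℕ} {Ω : Set (Euc (n + 1))} {F : Euc (n + 1) → ℝ}

theorem pot_hasF (hΩ : IsOpenProperConvexCone Ω) (hF : IsCanonicalPotential n Ω F)
    {x : Euc (n + 1)} (hx : x ∈ Ω) : HasFDerivAt F (fderiv ℝ F x) x := by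
  have h := hF.1.differentiableOn (by simp)
  exact (h.differentiableAt (hΩ.2.1.mem_nhds hx)).hasFDerivAt

theorem pot_hasF2 (hΩ : IsOpenProperConvexCone Ω) (hF : IsCanonicalPotential n Ω F)
    {x : Euc (n + 1)} (hx : x ∈ Ω) :
    HasFDerivAt (fderiv ℝ F) (fderiv ℝ (fderiv ℝ F) x) x := by
  have h1 : ContDiffOn ℝ 1 (fderiv ℝ F) Ω :=
    hF.1.fderiv_of_isOpen hΩ.2.1 (by
      have : ((2 : ℕ∞) : WithTop ℕ∞) ≤ ((⊤ : ℕ∞) : WithTop ℕ∞) := by exact_mod_cast le_top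
      refine le_trans (le_of_eq ?_) this
      norm_num)
  have h := h1.differentiableOn (by simp)
  exact (h.differentiableAt (hΩ.2.1.mem_nhds hx)).hasFDerivAt

theorem seg_mem (hΩ : IsOpenProperConvexCone Ω) {x y : Euc (n + 1)} (hx : x ∈ Ω) (hy : y ∈ Ω)
    {t : ℝ} (h0 : 0 ≤ t) (h1 : t ≤ 1) : x + t • (y - x) ∈ Ω :=
  hΩ.2.2.1.add_smul_sub_mem hx hy ⟨h0, h1⟩

theorem line_deriv (x v : Euc (n + 1)) (t : ℝ) :
    HasDerivAt (fun t : ℝ => x + t • v) v t := by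
  simpa using ((hasDerivAt_id t).smul_const v).const_add x

theorem grad_mono (hΩ : IsOpenProperConvexCone Ω) (hF : IsCanonicalPotential n Ω F)
    {x y : Euc (n + 1)} (hx : x ∈ Ω) (hy : y ∈ Ω) (hxy : x ≠ y) :
    fderiv ℝ F x (y - x) < fderiv ℝ F y (y - x) := by
  have hd : ∀ t ∈ Set.Icc (0 : ℝ) 1,
      HasDerivAt (fun t : ℝ => fderiv ℝ F (x + t • (y - x)) (y - x))
        (fderiv ℝ (fderiv ℝ F) (x + t • (y - x)) (y - x) (y - x)) t := by
    intro t ht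
    have h := (pot_hasF2 hΩ hF (seg_mem hΩ hx hy ht.1 ht.2)).comp_hasDerivAt t
      (line_deriv x (y - x) t)
    simpa using h.clm_apply (hasDerivAt_const t (y - x))
  obtain ⟨c, hc, h⟩ := exists_hasDerivAt_eq_slope _ _ (zero_lt_one (α := ℝ))
    (fun t ht => (hd t ht).continuousAt.continuousWithinAt)
    (fun t ht => hd t ⟨ht.1.le, ht.2.le⟩)
  have hp := hess_pos (hF.2.1 _ (seg_mem hΩ hx hy hc.1.le hc.2.le)) (sub_ne_zero.2 hxy.symm)
  rw [h] at hp
  simp only [one_smul, zero_smul, add_zero, sub_zero, div_one, add_sub_cancel] at hp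
  linarith

theorem pot_convex (hΩ : IsOpenProperConvexCone Ω) (hF : IsCanonicalPotential n Ω F)
    {x y : Euc (n + 1)} (hx : x ∈ Ω) (hy : y ∈ Ω) :
    F x + fderiv ℝ F x (y - x) ≤ F y := by
  by_cases hxy : x = y
  · subst hxy; simp
  have hd : ∀ t ∈ Set.Icc (0 : ℝ) 1,
      HasDerivAt (fun t : ℝ => F (x + t • (y - x)))
        (fderiv ℝ F (x + t • (y - x)) (y - x)) t := by
    intro t ht
    exact (pot_hasF hΩ hF (seg_mem hΩ hx hy ht.1 ht.2)).comp_hasDerivAt t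
      (line_deriv x (y - x) t)
  obtain ⟨c, hc, h⟩ := exists_hasDerivAt_eq_slope _ _ (zero_lt_one (α := ℝ))
    (fun t ht => (hd t ht).continuousAt.continuousWithinAt)
    (fun t ht => hd t ⟨ht.1.le, ht.2.le⟩)
  have hm := seg_mem hΩ hx hy hc.1.le hc.2.le
  have hne : x ≠ x + c • (y - x) := by
    intro h0
    have : c • (y - x) = 0 := by simpa using h0
    rcases smul_eq_zero.1 this with h1 | h1
    · exact hc.1.ne' h1
    · exact hxy (sub_eq_zero.1 h1).symm
  have hp := grad_mono hΩ hF hx hm hne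
  simp only [add_sub_cancel_left, map_smul, smul_eq_mul] at hp
  have hp' := lt_of_mul_lt_mul_left hp hc.1.le
  rw [h] at hp'
  simp only [one_smul, zero_smul, add_zero, sub_zero, div_one, add_sub_cancel] at hp'
  linarith

theorem fderiv_scale (hΩ : IsOpenProperConvexCone Ω) (hF : IsCanonicalPotential n Ω F)
    {x : Euc (n + 1)} (hx : x ∈ Ω) (t : ℝ) :
    fderiv ℝ F (Real.exp t • x) = Real.exp (-t) • fderiv ℝ F x := by
  have h1 := (pot_hasF hΩ hF (hΩ.2.2.2.1 x hx t)).comp x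
    ((hasFDerivAt_id x).const_smul (Real.exp t))
  have h2 : HasFDerivAt (fun y => F y - (n + 1) * t) (fderiv ℝ F x) x :=
    (pot_hasF hΩ hF hx).sub_const _
  have h3 : (F ∘ fun y => Real.exp t • y) =ᶠ[nhds x] fun y => F y - (n + 1) * t := by
    filter_upwards [hΩ.2.1.mem_nhds hx] with y hy
    exact hF.2.2.2.1 y hy t
  have h4 := (h2.congr_of_eventuallyEq h3).unique h1
  ext v
  rw [h4]
  simp [← mul_assoc, ← Real.exp_add]

theorem exp_line (x : Euc (n + 1)) :
    HasDerivAt (fun t : ℝ => Real.exp t • x) x 0 := by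
  simpa using (Real.hasDerivAt_exp 0).smul_const x

theorem euler1 (hΩ : IsOpenProperConvexCone Ω) (hF : IsCanonicalPotential n Ω F)
    {x : Euc (n + 1)} (hx : x ∈ Ω) : fderiv ℝ F x x = -(n + 1) := by
  have h0 : HasFDerivAt F (fderiv ℝ F x) (Real.exp 0 • x) := by
    simpa using pot_hasF hΩ hF hx
  have h1 := h0.comp_hasDerivAt (0 : ℝ) (exp_line x)
  have h2 : HasDerivAt (fun t : ℝ => F x - (n + 1) * t) (-(n + 1) : ℝ) 0 := by
    simpa using ((hasDerivAt_id (0 : ℝ)).const_mul (n + 1 : ℝ)).const_sub (F x)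
  have h3 : (F ∘ fun t : ℝ => Real.exp t • x) = fun t : ℝ => F x - (n + 1) * t :=
    funext fun t => hF.2.2.2.1 x hx t
  rw [h3] at h1
  exact h1.unique h2

theorem euler2 (hΩ : IsOpenProperConvexCone Ω) (hF : IsCanonicalPotential n Ω F)
    {x : Euc (n + 1)} (hx : x ∈ Ω) : fderiv ℝ (fderiv ℝ F) x x = -fderiv ℝ F x := by
  have h0 : HasFDerivAt (fderiv ℝ F) (fderiv ℝ (fderiv ℝ F) x) (Real.exp 0 • x) := by
    simpa using pot_hasF2 hΩ hF hx
  have h1 := h0.comp_hasDerivAt (0 : ℝ) (exp_line x)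
  have h2 : HasDerivAt (fun t : ℝ => Real.exp (-t) • fderiv ℝ F x) (-fderiv ℝ F x) 0 := by
    simpa using ((hasDerivAt_neg (0 : ℝ)).exp).smul_const (fderiv ℝ F x)
  have h3 : ((fderiv ℝ F) ∘ fun t : ℝ => Real.exp t • x)
      = fun t : ℝ => Real.exp (-t) • fderiv ℝ F x :=
    funext fun t => fderiv_scale hΩ hF hx t
  rw [h3] at h1
  exact h1.unique h2

theorem grad_nonpos (hΩ : IsOpenProperConvexCone Ω) (hF : IsCanonicalPotential n Ω F)
    {x z : Euc (n + 1)} (hx : x ∈ Ω) (hz : z ∈ closure Ω) : fderiv ℝ F x z ≤ 0 := by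
  have key : ∀ z ∈ Ω, fderiv ℝ F x z ≤ 0 := by
    intro z hz
    by_contra! hpos
    have h : ∀ t : ℝ, F x + Real.exp t * fderiv ℝ F x z + (n + 1) ≤ F z - (n + 1) * t := by
      intro t
      have h := pot_convex hΩ hF hx (hΩ.2.2.2.1 z hz t)
      rw [hF.2.2.2.1 z hz t, map_sub, euler1 hΩ hF hx, map_smul, smul_eq_mul] at h
      linarith
    have ht := h (max 0 (F z - F x))
    have h1 : 0 < Real.exp (max 0 (F z - F x)) * fderiv ℝ F x z := by positivity
    have h2 := le_max_left 0 (F z - F x)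
    have h3 := le_max_right 0 (F z - F x)
    have h4 : (0 : ℝ) ≤ n * max 0 (F z - F x) := by positivity
    have h5 : (0 : ℝ) ≤ n := by positivity
    nlinarith
  have hc : IsClosed {z | fderiv ℝ F x z ≤ 0} :=
    isClosed_le (fderiv ℝ F x).continuous continuous_const
  exact closure_minimal key hc hz

theorem add_mem_cone (hΩ : IsOpenProperConvexCone Ω)
    {x z : Euc (n + 1)} (hx : x ∈ Ω) (hz : z ∈ closure Ω) : x + z ∈ Ω := by
  have h := hΩ.2.2.1.combo_interior_closure_mem_interior (x := x) (y := z)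
    (by rwa [hΩ.2.1.interior_eq]) hz (a := 1 / 2) (b := 1 / 2) (by norm_num) (by norm_num)
    (by norm_num)
  rw [hΩ.2.1.interior_eq] at h
  have h2 := hΩ.2.2.2.1 _ h (Real.log 2)
  rw [Real.exp_log (by norm_num), ← smul_add, smul_smul] at h2
  norm_num at h2
  exact h2

theorem grad_neg (hΩ : IsOpenProperConvexCone Ω) (hF : IsCanonicalPotential n Ω F)
    {x z : Euc (n + 1)} (hx : x ∈ Ω) (hz : z ∈ closure Ω) (hz0 : z ≠ 0) :
    fderiv ℝ F x z < 0 := by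
  have hm := add_mem_cone hΩ hx hz
  have h := grad_mono hΩ hF hx hm (by simpa using hz0)
  rw [add_sub_cancel_left] at h
  exact h.trans_le (grad_nonpos hΩ hF hm hz)

theorem dual_lower (hΩ : IsOpenProperConvexCone Ω) {y : Euc (n + 1)} (hy : y ∈ openDualCone Ω) :
    ∃ c : ℝ, 0 < c ∧ ∀ x ∈ closure Ω, c * ‖x‖ ≤ ⟪x, y⟫ := by
  have hK : IsCompact (closure Ω ∩ Metric.sphere 0 1) :=
    (isCompact_sphere _ _).inter_left isClosed_closure
  obtain ⟨c, hc, h⟩ := hK.exists_forall_le' (f := fun x => ⟪x, y⟫)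
    (by fun_prop) (a := 0) (by
      rintro b ⟨hb, hb1⟩
      refine hy b hb ?_
      rintro rfl
      simp at hb1)
  refine ⟨c, hc, fun x hx => ?_⟩
  by_cases hx0 : x = 0
  · simp [hx0]
  have hn : 0 < ‖x‖ := norm_pos_iff.2 hx0
  have hm : ‖x‖⁻¹ • x ∈ closure Ω := by
    refine map_mem_closure (continuous_const_smul (‖x‖⁻¹)) hx fun w hw => ?_
    have := hΩ.2.2.2.1 w hw (Real.log ‖x‖⁻¹)
    rwa [Real.exp_log (by positivity)] at this
  have h1 := h _ ⟨hm, by simp [norm_smul, hn.ne']⟩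
  simp only [real_inner_smul_left] at h1
  rw [← div_eq_inv_mul, le_div_iff₀ hn] at h1
  exact h1

theorem grad_surj (hΩ : IsOpenProperConvexCone Ω) (hF : IsCanonicalPotential n Ω F)
    {y : Euc (n + 1)} (hy : y ∈ openDualCone Ω) :
    ∃ x ∈ Ω, ∀ v, fderiv ℝ F x v = -⟪v, y⟫ := by
  obtain ⟨c, hc, hcb⟩ := dual_lower hΩ hy
  obtain ⟨x0, hx0⟩ := hΩ.1
  set G : Euc (n + 1) → ℝ := fun x => F x + ⟪x, y⟫ with hG
  set K : Set (Euc (n + 1)) := {x | x ∈ Ω ∧ G x ≤ G x0} with hK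
  have hFc : ContinuousOn F Ω := hF.1.continuousOn
  have hGc : ContinuousOn G Ω := hFc.add (by fun_prop)
  have hb : Bornology.IsBounded K := by
    set N := ‖fderiv ℝ F x0‖ + 1 with hN
    have hNpos : 0 < N := by positivity
    obtain ⟨p, hp, hpn⟩ : ∃ p ∈ Ω, ‖fderiv ℝ F p‖ ≤ c / 2 := by
      refine ⟨_, hΩ.2.2.2.1 x0 hx0 (Real.log (2 * N / c)), ?_⟩
      rw [fderiv_scale hΩ hF hx0, norm_smul, Real.exp_neg, Real.exp_log (by positivity),
        Real.norm_of_nonneg (by positivity), inv_div, div_mul_eq_mul_div,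
        div_le_div_iff₀ (by positivity) (by positivity)]
      nlinarith [norm_nonneg (fderiv ℝ F x0)]
    refine (Metric.isBounded_closedBall (x := (0 : Euc (n + 1)))
      (r := (G x0 - F p + fderiv ℝ F p p) / (c / 2))).subset ?_
    rintro x ⟨hx, hxG⟩
    have h1 := pot_convex hΩ hF hp hx
    have h2 := hcb x (subset_closure hx)
    have h3 := (fderiv ℝ F p).le_opNorm x
    have h4 := neg_abs_le (fderiv ℝ F p x)
    rw [← Real.norm_eq_abs] at h4
    have h5 := mul_le_mul_of_nonneg_right hpn (norm_nonneg x)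
    rw [map_sub] at h1
    have h6 : F x + ⟪x, y⟫ ≤ G x0 := hxG
    rw [mem_closedBall_zero_iff, le_div_iff₀ (by positivity)]
    linarith
  have hKc : IsCompact K := by
    rw [Metric.isCompact_iff_isClosed_bounded]
    refine ⟨?_, hb⟩
    rw [← isSeqClosed_iff_isClosed]
    intro s z hs hz
    have hzc : z ∈ closure Ω :=
      mem_closure_of_tendsto hz (Filter.Eventually.of_forall fun k => (hs k).1)
    have hzΩ : z ∈ Ω := by
      by_contra hzn
      have hfr : z ∈ frontier Ω := by
        rw [hΩ.2.1.frontier_eq]; exact ⟨hzc, hzn⟩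
      have ht := hF.2.2.2.2 z hfr s (fun k => (hs k).1) hz
      obtain ⟨k, hk⟩ := (ht.eventually_gt_atTop (G x0)).exists
      have h1 : F (s k) + ⟪s k, y⟫ ≤ G x0 := (hs k).2
      have h2 := hcb _ (subset_closure (hs k).1)
      have h3 : 0 ≤ c * ‖s k‖ := by positivity
      linarith
    refine ⟨hzΩ, ?_⟩
    have hcont := (hGc.continuousAt (hΩ.2.1.mem_nhds hzΩ)).tendsto.comp hz
    exact le_of_tendsto' hcont fun k => (hs k).2
  obtain ⟨x, hxK, hxm⟩ := hKc.exists_isMinOn ⟨x0, hx0, le_rfl⟩ (hGc.mono fun x hx => hx.1)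
  refine ⟨x, hxK.1, ?_⟩
  have hmin : IsLocalMin G x := by
    filter_upwards [hΩ.2.1.mem_nhds hxK.1] with w hw
    by_cases hwk : G w ≤ G x0
    · exact hxm ⟨hw, hwk⟩
    · exact hxK.2.trans (not_le.1 hwk).le
  have hd : HasFDerivAt G (fderiv ℝ F x + innerSL ℝ y) x := by
    refine (pot_hasF hΩ hF hxK.1).add ?_
    have := (innerSL ℝ y).hasFDerivAt (x := x)
    refine this.congr_of_eventuallyEq (Filter.Eventually.of_forall fun w => ?_)
    simp [real_inner_comm]
  have h0 := hmin.hasFDerivAt_eq_zero hd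
  intro v
  have h1 := congrArg (fun L => L v) h0
  simp at h1
  rw [real_inner_comm]
  linarith

theorem u_hasF (hΩ : IsOpenProperConvexCone Ω) (hF : IsCanonicalPotential n Ω F)
    {u : Euc (n + 1) → ℝ}
    (hu : u = fun x => -((n + 1 : ℝ) / 2) * Real.exp (-2 * F x / (n + 1)))
    {x : Euc (n + 1)} (hx : x ∈ Ω) :
    fderiv ℝ u x = Real.exp (-2 * F x / (n + 1)) • fderiv ℝ F x := by
  have h := ((((pot_hasF hΩ hF hx).const_mul (-2 : ℝ)).mul_const ((n + 1 : ℝ)⁻¹)).exp).const_mul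
    (-((n + 1 : ℝ) / 2))
  rw [hu]
  have h' := h.fderiv
  simp only [← div_eq_mul_inv] at h'
  rw [h']
  have hn : (n + 1 : ℝ) ≠ 0 := by positivity
  ext v
  simp
  field_simp

theorem exp_hasF (hΩ : IsOpenProperConvexCone Ω) (hF : IsCanonicalPotential n Ω F)
    {x : Euc (n + 1)} (hx : x ∈ Ω) :
    HasFDerivAt (fun x => Real.exp (-2 * F x / (n + 1)))
      ((Real.exp (-2 * F x / (n + 1)) * (-2 / (n + 1))) • fderiv ℝ F x) x := by
  have h := (((pot_hasF hΩ hF hx).const_mul (-2 : ℝ)).mul_const ((n + 1 : ℝ)⁻¹)).exp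
  simp only [← div_eq_mul_inv] at h
  refine h.congr_fderiv ?_
  ext v
  simp only [smul_apply, smul_eq_mul]
  field_simp

theorem u_hess (hΩ : IsOpenProperConvexCone Ω) (hF : IsCanonicalPotential n Ω F)
    {u : Euc (n + 1) → ℝ}
    (hu : u = fun x => -((n + 1 : ℝ) / 2) * Real.exp (-2 * F x / (n + 1)))
    {x : Euc (n + 1)} (hx : x ∈ Ω) (v w : Euc (n + 1)) :
    fderiv ℝ (fderiv ℝ u) x v w = Real.exp (-2 * F x / (n + 1)) *
      (fderiv ℝ (fderiv ℝ F) x v w - 2 / (n + 1) * fderiv ℝ F x v * fderiv ℝ F x w) := by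
  have he : fderiv ℝ u =ᶠ[nhds x] fun x => Real.exp (-2 * F x / (n + 1)) • fderiv ℝ F x := by
    filter_upwards [hΩ.2.1.mem_nhds hx] with z hz
    exact u_hasF hΩ hF hu hz
  have h := (exp_hasF hΩ hF hx).smul (pot_hasF2 hΩ hF hx)
  have h2 := HasFDerivAt.fderiv (f := fun x => Real.exp (-2 * F x / (n + 1)) • fderiv ℝ F x) h
  rw [he.fderiv_eq, h2]
  simp
  ring

end

/-- For `u = -((n+1)/2) e^{-2F/(n+1)}` built from the canonical potential `F` of `Ω`, the
map `x ↦ -∇u(x)` is a bijection from `Ω` onto `Ω*` with invertible derivative `-D²u(x)`. -/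
theorem neg_gradient_u_bijOn
    (n : ℕ) (Ω : Set (Euc (n + 1))) (hΩ : IsOpenProperConvexCone Ω)
    (F : Euc (n + 1) → ℝ) (hF : IsCanonicalPotential n Ω F)
    (u : Euc (n + 1) → ℝ)
    (hu : u = fun x => -((n + 1 : ℝ) / 2) * Real.exp (-2 * F x / (n + 1))) :
    Set.BijOn (fun x => -gradient u x) Ω (openDualCone Ω) ∧
    ∀ x ∈ Ω, (-(hessMatrix u x)).det ≠ 0 := by
  have hn : (0 : ℝ) < n + 1 := by positivity
  have hgrad : ∀ x ∈ Ω, ∀ v, ⟪v, gradient u x⟫ =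
      Real.exp (-2 * F x / (n + 1)) * fderiv ℝ F x v := by
    intro x hx v
    rw [real_inner_comm, inner_gradient_left, u_hasF hΩ hF hu hx]
    simp
  refine ⟨⟨?_, ?_, ?_⟩, ?_⟩
  · intro x hx z hz hz0
    simp only [inner_neg_right, hgrad x hx]
    have := mul_pos (Real.exp_pos (-2 * F x / (n + 1))) (neg_pos.2 (grad_neg hΩ hF hx hz hz0))
    linarith
  · intro x hx y hy hxy
    have hxy' : gradient u x = gradient u y := neg_injective hxy
    have h : ∀ v, Real.exp (-2 * F x / (n + 1)) * fderiv ℝ F x v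
        = Real.exp (-2 * F y / (n + 1)) * fderiv ℝ F y v := fun v => by
      rw [← hgrad x hx, ← hgrad y hy, hxy']
    set s : ℝ := -2 * F x / (n + 1) - -2 * F y / (n + 1) with hs
    have hsy := hΩ.2.2.2.1 y hy s
    have hx1 : x = Real.exp s • y := by
      by_contra hne
      have hm := grad_mono hΩ hF hx hsy hne
      rw [fderiv_scale hΩ hF hy] at hm
      set v := Real.exp s • y - x
      have hv := h v
      have e1 : fderiv ℝ F x v = Real.exp (-s) * fderiv ℝ F y v := by
        have : Real.exp (-s) = Real.exp (-2 * F y / (n + 1)) / Real.exp (-2 * F x / (n + 1)) := by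
          rw [← Real.exp_sub]; congr 1; rw [hs]; ring
        rw [this, div_mul_eq_mul_div, eq_div_iff (Real.exp_pos _).ne']
        linarith
      rw [e1] at hm
      simp at hm
    have hFx : F x = F y - (n + 1) * s := by rw [hx1]; exact hF.2.2.2.1 y hy s
    have hs2 : s = 2 * s := by
      rw [hFx] at hs
      field_simp at hs
      refine mul_right_cancel₀ hn.ne' ?_
      linarith
    have hs0 : s = 0 := by linarith
    rw [hx1, hs0]; simp
  · intro y hy
    obtain ⟨x, hx, hxy⟩ := grad_surj hΩ hF hy
    set t : ℝ := 2 * F x / (n + 1) with ht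
    refine ⟨Real.exp t • x, hΩ.2.2.2.1 x hx t, ?_⟩
    refine ext_inner_left ℝ fun v => ?_
    rw [inner_neg_right, hgrad _ (hΩ.2.2.2.1 x hx t), fderiv_scale hΩ hF hx, hF.2.2.2.1 x hx t]
    simp only [smul_apply, smul_eq_mul, hxy, ← mul_assoc, ← Real.exp_add]
    have : -2 * (F x - (n + 1) * t) / (n + 1) + -t = 0 := by
      rw [ht]; field_simp; ring
    rw [this]; simp
  · intro x hx hdet
    rw [Matrix.det_neg, mul_eq_zero] at hdet
    have hdet' : (hessMatrix u x).det = 0 := hdet.resolve_left (pow_ne_zero _ (by norm_num))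
    obtain ⟨v0, hv0, hv⟩ := Matrix.exists_vecMul_eq_zero_iff.2 hdet'
    set v : Euc (n + 1) := WithLp.toLp 2 v0 with hvdef
    have hvne : v ≠ 0 := by
      intro h0
      apply hv0
      have := congrArg WithLp.ofLp h0
      simpa [hvdef] using this
    have hz : ∀ w : Euc (n + 1), fderiv ℝ (fderiv ℝ u) x v w = 0 := by
      intro w
      rw [← hess_quad]
      have : Matrix.vecMul (v : Fin (n + 1) → ℝ) (hessMatrix u x) = 0 := hv
      rw [this]; simp
    set a : ℝ := 2 / (n + 1) * fderiv ℝ F x v with ha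
    have h1 : ∀ w, fderiv ℝ (fderiv ℝ F) x (v + a • x) w = 0 := by
      intro w
      have h := hz w
      rw [u_hess hΩ hF hu hx] at h
      have h' := (mul_eq_zero.1 h).resolve_left (Real.exp_pos _).ne'
      rw [map_add, map_smul, euler2 hΩ hF hx]
      simp only [add_apply, smul_apply,
        neg_apply, smul_eq_mul]
      linarith
    have h2 : v + a • x = 0 := by
      by_contra hne
      exact (hess_pos (hF.2.1 x hx) hne).ne' (h1 _)
    have h3 : fderiv ℝ F x v + a * -(n + 1) = 0 := by
      rw [← euler1 hΩ hF hx, ← smul_eq_mul, ← map_smul, ← map_add, h2, map_zero]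
    have h4 : fderiv ℝ F x v = 0 := by
      rw [ha] at h3
      field_simp at h3
      linarith
    apply hvne
    rw [ha, h4] at h2
    simpa using h2
end
end
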